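/- Every 2-connected outerplanar graph G with maximum degree at most Δ, other than C_4 and K_4 − e, satisfies q_B(G) ≤ Δ + 1. -/

import Mathlib

open SimpleGraph

variable {V : Type*}

/-- Four distinct vertices forming a 4-cycle in `G`. -/
def IsC4 (G : SimpleGraph V) (a b c d : V) : Prop :=
  a ≠ b ∧ a ≠ c ∧ a ≠ d ∧ b ≠ c ∧ b ≠ d ∧ c ≠ d ∧
    G.Adj a b ∧ G.Adj b c ∧ G.Adj c d ∧ G.Adj d a

/-- A proper edge coloring of `G` in which every 4-cycle is rainbow. -/
def IsBColoring (G : SimpleGraph V) {α : Type*} (C : Sym2 V → α) : Prop :=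
  (∀ a b c : V, G.Adj a b → G.Adj a c → b ≠ c → C s(a, b) ≠ C s(a, c)) ∧
  (∀ a b c d : V, IsC4 G a b c d →
    C s(a, b) ≠ C s(b, c) ∧ C s(a, b) ≠ C s(c, d) ∧ C s(a, b) ≠ C s(d, a) ∧
    C s(b, c) ≠ C s(c, d) ∧ C s(b, c) ≠ C s(d, a) ∧ C s(c, d) ≠ C s(d, a))

/-- The minimum number of colors in a B-coloring of `G`. -/
noncomputable def qB (G : SimpleGraph V) : ℕ :=
  sInf {n | ∃ C : Sym2 V → Fin n, IsBColoring G C}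

/-- `e` and `f` are opposite edges of some 4-cycle of `G`. -/
def OppC4 (G : SimpleGraph V) (e f : Sym2 V) : Prop :=
  ∃ a b c d : V, IsC4 G a b c d ∧ e = s(a, b) ∧ f = s(c, d)

/-- Two edges (as unordered pairs) share no vertex. -/
def EdgeDisjoint (e f : Sym2 V) : Prop := ∀ v : V, v ∈ e → v ∉ f

/-- The graph `F(G)` on the edges of `G`: two vertex-disjoint edges are adjacent
iff they are opposite edges of a 4-cycle of `G`. -/
def Fgraph (G : SimpleGraph V) : SimpleGraph G.edgeSet :=
  SimpleGraph.fromRel fun e f =>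
    EdgeDisjoint (e : Sym2 V) (f : Sym2 V) ∧ OppC4 G (e : Sym2 V) (f : Sym2 V)

/-- The extended line graph `L⁺(G)`: edges of `G` are adjacent if they share an
endpoint or are opposite edges of a 4-cycle of `G`. -/
def Lplus (G : SimpleGraph V) : SimpleGraph G.edgeSet :=
  SimpleGraph.fromRel fun e f =>
    (∃ v : V, v ∈ (e : Sym2 V) ∧ v ∈ (f : Sym2 V)) ∨ OppC4 G (e : Sym2 V) (f : Sym2 V)

/-- `H` is a minor of `G`, via branch sets. -/
def HasMinor {W : Type*} (G : SimpleGraph V) (H : SimpleGraph W) : Prop :=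
  ∃ B : W → Set V,
    (∀ w, (G.induce (B w)).Connected) ∧
    (∀ w₁ w₂, w₁ ≠ w₂ → Disjoint (B w₁) (B w₂)) ∧
    (∀ w₁ w₂, H.Adj w₁ w₂ → ∃ v₁ ∈ B w₁, ∃ v₂ ∈ B w₂, G.Adj v₁ v₂)

/-- Planarity via Wagner's theorem: no `K₅` minor and no `K₃,₃` minor. -/
def IsPlanar (G : SimpleGraph V) : Prop :=
  ¬ HasMinor G (completeGraph (Fin 5)) ∧
    ¬ HasMinor G (completeBipartiteGraph (Fin 3) (Fin 3))

/-- Outerplanarity: no `K₄` minor and no `K₂,₃` minor. -/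
def IsOuterplanar (G : SimpleGraph V) : Prop :=
  ¬ HasMinor G (completeGraph (Fin 4)) ∧
    ¬ HasMinor G (completeBipartiteGraph (Fin 2) (Fin 3))

/-- `G` is 2-connected: at least 3 vertices and removing any vertex leaves it connected. -/
def IsTwoConnected (G : SimpleGraph V) : Prop :=
  3 ≤ Nat.card V ∧ ∀ v : V, (G.induce {u | u ≠ v}).Connected

/-- `K₄` minus one edge, on `Fin 4` (the edge between `2` and `3` removed). -/
def K4e : SimpleGraph (Fin 4) :=
  SimpleGraph.fromRel fun x y => s(x, y) ≠ s((2 : Fin 4), (3 : Fin 4))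

/-- The chromatic index: minimum number of colors in a proper edge coloring. -/
noncomputable def chromIndex (G : SimpleGraph V) : ℕ :=
  sInf {n | ∃ C : Sym2 V → Fin n,
    ∀ a b c : V, G.Adj a b → G.Adj a c → b ≠ c → C s(a, b) ≠ C s(a, c)}

/-- `K₆` minus a perfect matching, on `Fin 6` (the matching `01, 23, 45` removed). -/
def K6mM : SimpleGraph (Fin 6) :=
  SimpleGraph.fromRel fun x y => (x : ℕ) / 2 ≠ (y : ℕ) / 2

/-- A path `v₀v₁v₂v₃` together with a vertex `4` adjacent to all four path vertices. -/
def FanGraph : SimpleGraph (Fin 5) :=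
  SimpleGraph.fromRel fun x y =>
    ((x : ℕ) + 1 = (y : ℕ) ∧ (y : ℕ) ≤ 3) ∨ (x : ℕ) = 4

theorem sym2_mk_ne {α : Type*} {a b c d : α} (h : a ≠ c ∨ b ≠ d) (h' : a ≠ d ∨ b ≠ c) :
    s(a, b) ≠ s(c, d) := by
  rw [Ne, Sym2.eq_iff]; tauto

theorem IsC4.rotate {V : Type*} {G : SimpleGraph V} {a b c d : V} (h : IsC4 G a b c d) :
    IsC4 G b c d a := by
  obtain ⟨hab, hac, had, hbc, hbd, hcd, eab, ebc, ecd, eda⟩ := h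
  exact ⟨hbc, hbd, hab.symm, hcd, hac.symm, had.symm, ebc, ecd, eda, eab⟩

theorem IsBColoring.of_opp {V α : Type*} {G : SimpleGraph V} {C : Sym2 V → α}
    (hp : ∀ a b c : V, G.Adj a b → G.Adj a c → b ≠ c → C s(a, b) ≠ C s(a, c))
    (ho : ∀ a b c d : V, IsC4 G a b c d → C s(a, b) ≠ C s(c, d)) : IsBColoring G C := by
  refine ⟨hp, fun a b c d h => ?_⟩
  have h1 := ho a b c d h
  obtain ⟨hab, hac, had, hbc, hbd, hcd, eab, ebc, ecd, eda⟩ := h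
  have h2 := ho b c d a ⟨hbc, hbd, hab.symm, hcd, hac.symm, had.symm, ebc, ecd, eda, eab⟩
  have k1 := hp b a c eab.symm ebc hac
  have k2 := hp a b d eab eda.symm hbd
  have k3 := hp c b d ebc.symm ecd hbd
  have k4 := hp d c a ecd.symm eda hac.symm
  rw [Sym2.eq_swap] at k1 k3 k4
  refine ⟨k1, h1, ?_, ?_, h2, k4⟩
  · rwa [Sym2.eq_swap (a := d)]
  · exact k3

/-- B-colorings pull back along locally injective homomorphisms. -/
theorem IsBColoring.pullback {V W α : Type*} {G : SimpleGraph V} {H : SimpleGraph W}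
    {C : Sym2 W → α} (hC : IsBColoring H C) (g : V → W)
    (hom : ∀ a b, G.Adj a b → H.Adj (g a) (g b))
    (inj : ∀ a b c, G.Adj a b → G.Adj a c → b ≠ c → g b ≠ g c) :
    IsBColoring G (C ∘ Sym2.map g) := by
  refine .of_opp (fun a b c hab hac hbc => ?_) (fun a b c d h => ?_)
  · exact hC.1 _ _ _ (hom _ _ hab) (hom _ _ hac) (inj _ _ _ hab hac hbc)
  · obtain ⟨hab, hac, had, hbc, hbd, hcd, eab, ebc, ecd, eda⟩ := h
    exact (hC.2 (g a) (g b) (g c) (g d) ⟨(hom _ _ eab).ne, inj b a c eab.symm ebc hac,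
      (hom _ _ eda).ne', (hom _ _ ebc).ne, inj a b d eab eda.symm hbd, (hom _ _ ecd).ne,
      hom _ _ eab, hom _ _ ebc, hom _ _ ecd, hom _ _ eda⟩).2.1

open Classical in
/-- Extending a B-coloring by one edge `pq` colored `γ`. -/
theorem IsBColoring.update_edge {V α : Type*} {G₀ G : SimpleGraph V} {C : Sym2 V → α}
    (hC : IsBColoring G₀ C) (p q : V) (γ : α)
    (hG : ∀ a b, G.Adj a b → G₀.Adj a b ∨ s(a, b) = s(p, q))
    (hp : ∀ r, r ≠ q → G₀.Adj p r → γ ≠ C s(p, r)) (hq : ∀ r, r ≠ p → G₀.Adj q r → γ ≠ C s(q, r))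
    (ho : ∀ r t, r ≠ q → t ≠ p → G₀.Adj p r → G₀.Adj r t → G₀.Adj t q →
      γ ≠ C s(r, t) ∧ C s(p, r) ≠ C s(q, t)) :
    IsBColoring G (Function.update C s(p, q) γ) := by
  have key : ∀ a b c d, IsC4 G a b c d → s(a, b) = s(p, q) →
      γ ≠ C s(c, d) ∧ C s(b, c) ≠ C s(d, a) := by
    rintro a b c d ⟨hab, hac, had, hbc, hbd, hcd, eab, ebc, ecd, eda⟩ h
    have e1 : G₀.Adj b c := (hG b c ebc).resolve_right fun h2 =>
      sym2_mk_ne (.inl hab) (.inl hac) (h.trans h2.symm)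
    have e2 : G₀.Adj c d := (hG c d ecd).resolve_right fun h2 =>
      sym2_mk_ne (.inl hac) (.inl had) (h.trans h2.symm)
    have e3 : G₀.Adj d a := (hG d a eda).resolve_right fun h2 =>
      sym2_mk_ne (.inl had) (.inr hbd) (h.trans h2.symm)
    rcases Sym2.eq_iff.1 h with ⟨rfl, rfl⟩ | ⟨rfl, rfl⟩
    · rw [Sym2.eq_swap (a := c), Sym2.eq_swap (a := d) (b := a)]
      exact ⟨(ho d c hbd.symm hac.symm e3.symm e2.symm e1.symm).1,
        (ho d c hbd.symm hac.symm e3.symm e2.symm e1.symm).2.symm⟩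
    · rw [Sym2.eq_swap (a := d) (b := a)]
      exact ho c d hac.symm hbd.symm e1 e2 e3
  refine .of_opp (fun a b c hab hac hbc => ?_) (fun a b c d h => ?_)
  · have key2 : ∀ a b c, G.Adj a b → G.Adj a c → b ≠ c → s(a, b) = s(p, q) →
        γ ≠ C s(a, c) := by
      intro a b c hab hac hbc h
      have e : G₀.Adj a c := (hG a c hac).resolve_right fun h2 =>
        hbc (Sym2.congr_right.1 (h.trans h2.symm))
      rcases Sym2.eq_iff.1 h with ⟨rfl, rfl⟩ | ⟨rfl, rfl⟩
      · exact hp c hbc.symm e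
      · exact hq c hbc.symm e
    by_cases h1 : s(a, b) = s(p, q)
    · have h2 : s(a, c) ≠ s(p, q) := fun h2 => hbc (Sym2.congr_right.1 (h1.trans h2.symm))
      simpa [h1, h2] using key2 a b c hab hac hbc h1
    · by_cases h2 : s(a, c) = s(p, q)
      · simpa [h1, h2] using (key2 a c b hac hab hbc.symm h2).symm
      · simpa [h1, h2] using hC.1 a b c ((hG _ _ hab).resolve_right h1)
          ((hG _ _ hac).resolve_right h2) hbc
  · by_cases h1 : s(a, b) = s(p, q)
    · have h2 : s(c, d) ≠ s(p, q) := fun h2 =>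
        sym2_mk_ne (.inl h.2.1) (.inl h.2.2.1) (h1.trans h2.symm)
      simpa [h1, h2] using (key a b c d h h1).1
    · by_cases h2 : s(c, d) = s(p, q)
      · simpa [h1, h2] using (key c d a b h.rotate.rotate h2).1.symm
      · simp only [ne_eq, h1, not_false_eq_true, Function.update_of_ne, h2]
        by_cases h3 : s(b, c) = s(p, q)
        · exact (key b c d a h.rotate h3).2.symm
        by_cases h4 : s(d, a) = s(p, q)
        · exact (key d a b c h.rotate.rotate.rotate h4).2
        obtain ⟨hab, hac, had, hbc, hbd, hcd, eab, ebc, ecd, eda⟩ := h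
        exact (hC.2 a b c d ⟨hab, hac, had, hbc, hbd, hcd, (hG _ _ eab).resolve_right h1,
          (hG _ _ ebc).resolve_right h3, (hG _ _ ecd).resolve_right h2,
          (hG _ _ eda).resolve_right h4⟩).2.1

/-- The graph `G` with all edges meeting `S` removed. -/
def outside {V : Type*} (G : SimpleGraph V) (S : Set V) : SimpleGraph V where
  Adj a b := G.Adj a b ∧ a ∉ S ∧ b ∉ S
  symm := ⟨fun _ _ h => ⟨h.1.symm, h.2.2, h.2.1⟩⟩
  loopless := ⟨fun _ h => h.1.ne rfl⟩

theorem outside_adj {V : Type*} {G : SimpleGraph V} {S : Set V} {a b : V} :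
    (outside G S).Adj a b ↔ G.Adj a b ∧ a ∉ S ∧ b ∉ S := Iff.rfl

/-- Attaching a pendant edge `xp`. -/
theorem IsBColoring.pendant {V α : Type*} {G₀ G : SimpleGraph V} {C : Sym2 V → α}
    (hC : IsBColoring G₀ C) {x p : V} (h0 : ∀ t, ¬ G₀.Adj x t)
    (hG : ∀ a b, a ≠ x → b ≠ x → G.Adj a b → G₀.Adj a b) (hN : ∀ t, G.Adj x t → t = p) (γ : α)
    (hγ : ∀ t, G₀.Adj p t → γ ≠ C s(p, t)) :
    ∃ C' : Sym2 V → α, IsBColoring G C' ∧ C' s(x, p) = γ ∧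
      ∀ a b, a ≠ x → b ≠ x → C' s(a, b) = C s(a, b) := by
  classical
  refine ⟨_, hC.update_edge x p γ (fun a b hab => ?_) (fun r _ h => absurd h (h0 r))
    (fun r _ h => hγ r h) (fun r _ _ _ h => absurd h (h0 r)), by simp, fun a b ha hb => ?_⟩
  · by_cases ha : a = x
    · subst ha; right; rw [hN b hab]
    by_cases hb : b = x
    · subst hb; right; rw [hN a hab.symm, Sym2.eq_swap]
    exact .inl (hG a b ha hb hab)
  · exact Function.update_of_ne (sym2_mk_ne (.inl ha) (.inr hb)) _ _

/-- Attaching a triangle with apex `x` on the pair `u`, `v`. -/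
theorem IsBColoring.triangle {V K : Type*} {G₀ G : SimpleGraph V} {C : Sym2 V → K}
    (hC : IsBColoring G₀ C) {x u v : V} (hxu : x ≠ u) (hxv : x ≠ v) (huv : u ≠ v)
    (h0 : ∀ t, ¬ G₀.Adj x t)
    (hG : ∀ a b, a ≠ x → b ≠ x → G.Adj a b → G₀.Adj a b)
    (hN : ∀ t, G.Adj x t → t = u ∨ t = v) {α β : K} (hαβ : α ≠ β)
    (hα : ∀ t, G₀.Adj u t → α ≠ C s(u, t)) (hβ : ∀ t, G₀.Adj v t → β ≠ C s(v, t))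
    (hα' : ∀ t, G₀.Adj u t → G₀.Adj v t → α ≠ C s(v, t))
    (hβ' : ∀ t, G₀.Adj u t → G₀.Adj v t → β ≠ C s(u, t)) :
    ∃ C' : Sym2 V → K, IsBColoring G C' ∧ C' s(x, u) = α ∧ C' s(x, v) = β ∧
      ∀ a b, a ≠ x → b ≠ x → C' s(a, b) = C s(a, b) := by
  classical
  have hne : s(x, u) ≠ s(x, v) := fun h => huv (Sym2.congr_right.1 h)
  let G₁ : SimpleGraph V := G₀ ⊔ SimpleGraph.edge x u
  have hG₁ : ∀ a b, G₁.Adj a b ↔ G₀.Adj a b ∨ s(a, b) = s(x, u) := by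
    intro a b
    simp only [G₁, SimpleGraph.sup_adj, SimpleGraph.edge_adj, Sym2.eq_iff]
    grind
  have h1x : ∀ t, G₁.Adj x t → t = u := by
    intro t ht
    rcases (hG₁ x t).1 ht with h | h
    · exact absurd h (h0 t)
    · exact Sym2.congr_right.1 h
  have h1a : ∀ a b, a ≠ x → b ≠ x → G₁.Adj a b → G₀.Adj a b := by
    intro a b ha hb h
    exact ((hG₁ a b).1 h).resolve_right (sym2_mk_ne (.inl ha) (.inr hb))
  obtain ⟨C₁, hC₁, e1, e2⟩ := hC.pendant (G := G₁) (x := x) (p := u) h0 h1a h1x α hα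
  refine ⟨_, hC₁.update_edge x v β (fun a b hab => ?_) (fun r hr h => ?_) (fun r hr h => ?_)
    (fun r t hr ht h1 h2 h3 => ?_), ?_, by simp, fun a b ha hb => ?_⟩
  · rw [hG₁]
    by_cases ha : a = x
    · subst ha
      rcases hN b hab with rfl | rfl <;> simp
    by_cases hb : b = x
    · subst hb
      rcases hN a hab.symm with rfl | rfl
      · exact .inl (.inr Sym2.eq_swap)
      · exact .inr Sym2.eq_swap
    exact .inl (.inl (hG a b ha hb hab))
  · rw [h1x r h, e1]; exact hαβ.symm
  · rw [e2 v r hxv.symm hr]; exact hβ r (h1a v r hxv.symm hr h)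
  · obtain rfl := h1x r h1
    have k2 := h1a r t hxu.symm ht h2
    have k3 := (h1a t v ht hxv.symm h3).symm
    rw [e1, e2 r t hxu.symm ht, e2 v t hxv.symm ht]
    exact ⟨hβ' t k2 k3, hα' t k2 k3⟩
  · rw [Function.update_of_ne hne, e1]
  · rw [Function.update_of_ne (sym2_mk_ne (.inl ha) (.inr hb)), e2 a b ha hb]

/-- Joining the ends of the pendant edges `px` and `yq` by an edge `xy`. -/
theorem IsBColoring.join {V K : Type*} {G₀ G : SimpleGraph V} {C : Sym2 V → K}
    (hC : IsBColoring G₀ C) {x y p q : V}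
    (hG : ∀ a b, G.Adj a b → G₀.Adj a b ∨ s(a, b) = s(x, y))
    (hx : ∀ t, G₀.Adj x t → t = p) (hy : ∀ t, G₀.Adj y t → t = q) {γ : K}
    (h1 : γ ≠ C s(x, p)) (h2 : γ ≠ C s(y, q)) (h3 : γ ≠ C s(p, q)) (h4 : C s(x, p) ≠ C s(y, q)) :
    ∃ C' : Sym2 V → K, IsBColoring G C' ∧ C' s(x, y) = γ ∧
      ∀ e, e ≠ s(x, y) → C' e = C e := by
  classical
  refine ⟨_, hC.update_edge x y γ hG (fun r _ h => ?_) (fun r _ h => ?_)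
    (fun r t _ _ e1 e2 e3 => ?_), by simp, fun e he => Function.update_of_ne he _ _⟩
  · rwa [hx r h]
  · rwa [hy r h]
  · rw [hx r e1, hy t e3.symm]; exact ⟨h3, h4⟩

theorem exists_notMem_of_card_lt {n : ℕ} (s : Finset (Fin n)) (h : s.card < n) : ∃ c, c ∉ s := by
  by_contra! hc
  have := Finset.card_eq_iff_eq_univ s |>.2 (by ext; simp [hc])
  simp at this; omega

set_option maxHeartbeats 1000000 in
/-- Five vertices `v, x, u, y, w` forming three triangles `vxu`, `uyw`, `vuw`, attached to the rest
by the edges `v z₁` and `w z₂` only. -/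
theorem IsBColoring.threeTriangles {V : Type*} {G₀ G : SimpleGraph V} {k : ℕ} (hk : 5 ≤ k)
    {C : Sym2 V → Fin k} (hC : IsBColoring G₀ C) {v x u y w z₁ z₂ : V}
    (hd : [v, x, u, y, w].Nodup) (hz₁ : z₁ ∉ [v, x, u, y, w]) (hz₂ : z₂ ∉ [v, x, u, y, w])
    (hG : ∀ a b, G.Adj a b → G₀.Adj a b ∨ (a ∈ [v, x, u, y, w] ∧ b ∈ [v, x, u, y, w]))
    (hv : ∀ t, G₀.Adj v t → t = z₁) (hw : ∀ t, G₀.Adj w t → t = z₂)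
    (hx : ∀ t, G.Adj x t → t = v ∨ t = u) (hy : ∀ t, G.Adj y t → t = u ∨ t = w)
    (hu : ∀ t, ¬ G₀.Adj u t) (hx0 : ∀ t, ¬ G₀.Adj x t)
    (hab : C s(v, z₁) ≠ C s(w, z₂)) :
    ∃ C' : Sym2 V → Fin k, IsBColoring G C' := by
  simp only [List.nodup_cons, List.mem_cons, List.not_mem_nil, or_false, not_or, not_false_eq_true,
    List.nodup_nil, and_true] at hd hz₁ hz₂ hG
  obtain ⟨⟨hvx, hvu, hvy, hvw⟩, ⟨hxu, hxy, hxw⟩, ⟨huy, huw⟩, hyw⟩ := hd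
  set a := C s(v, z₁) with ha
  set b := C s(w, z₂) with hb
  obtain ⟨c, hc⟩ := exists_notMem_of_card_lt {a, b, C s(z₁, z₂)}
    (lt_of_le_of_lt Finset.card_le_three (by omega))
  obtain ⟨d, hd⟩ := exists_notMem_of_card_lt {a, b, c}
    (lt_of_le_of_lt Finset.card_le_three (by omega))
  obtain ⟨e, he⟩ := exists_notMem_of_card_lt {a, b, c, d}
    (lt_of_le_of_lt Finset.card_le_four (by omega))
  simp only [Finset.mem_insert, Finset.mem_singleton, not_or] at hc hd he
  obtain ⟨hca, hcb, hcz⟩ := hc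
  obtain ⟨hda, hdb, hdc⟩ := hd
  obtain ⟨hea, heb, hec, hed⟩ := he
  obtain ⟨C₁, hC₁, f1, g1⟩ := hC.join (G := outside G {x, u, y}) (x := v) (y := w) (p := z₁)
    (q := z₂) (γ := c) (by
      intro s t h
      simp only [outside_adj, Set.mem_insert_iff, Set.mem_singleton_iff, not_or] at h
      rw [Sym2.eq_iff]
      have := hG s t h.1
      have := h.1.ne
      grind) hv hw hca hcb hcz hab
  have k1 : C₁ s(v, z₁) = a := g1 _ (sym2_mk_ne (.inr (by tauto)) (.inl (by tauto)))
  have k2 : C₁ s(w, z₂) = b := g1 _ (sym2_mk_ne (.inl (by tauto)) (.inr (by tauto)))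
  have nv : ∀ t, (outside G {x, u, y}).Adj v t → C₁ s(v, t) = a ∨ t = w ∧ C₁ s(v, t) = c := by
    intro t h
    simp only [outside_adj, Set.mem_insert_iff, Set.mem_singleton_iff, not_or] at h
    rcases hG v t h.1 with h' | h'
    · left; rw [hv t h', k1]
    · have := h.1.ne
      right; obtain rfl : t = w := by tauto
      exact ⟨rfl, f1⟩
  have nw : ∀ t, (outside G {x, u, y}).Adj w t → C₁ s(w, t) = b ∨ t = v ∧ C₁ s(w, t) = c := by
    intro t h
    simp only [outside_adj, Set.mem_insert_iff, Set.mem_singleton_iff, not_or] at h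
    rcases hG w t h.1 with h' | h'
    · left; rw [hw t h', k2]
    · have := h.1.ne
      right; obtain rfl : t = v := by tauto
      exact ⟨rfl, by rw [Sym2.eq_swap, f1]⟩
  obtain ⟨C₂, hC₂, f2, f2', g2⟩ := hC₁.triangle (G := outside G {x, y}) (x := u) (u := v) (v := w)
    (α := d) (β := e) (Ne.symm hvu) huw hvw (by simp [outside_adj])
    (by intro s t h1 h2 h; simp [outside_adj] at h ⊢; tauto)
    (by
      intro t h
      simp only [outside_adj, Set.mem_insert_iff, Set.mem_singleton_iff, not_or] at h
      have := hG u t h.1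
      have := h.1.ne
      have := hu t
      tauto) (by tauto)
    (by intro t h; rcases nv t h with h | ⟨_, h⟩ <;> rw [h] <;> assumption)
    (by intro t h; rcases nw t h with h | ⟨_, h⟩ <;> rw [h] <;> assumption)
    (by intro t _ h; rcases nw t h with h | ⟨_, h⟩ <;> rw [h] <;> assumption)
    (by intro t h _; rcases nv t h with h | ⟨_, h⟩ <;> rw [h] <;> assumption)
  have nu2 : ∀ t, (outside G {x, y}).Adj u t →
      t = v ∧ C₂ s(u, t) = d ∨ t = w ∧ C₂ s(u, t) = e := by
    intro t h
    simp only [outside_adj, Set.mem_insert_iff, Set.mem_singleton_iff, not_or] at h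
    have h1 := hG u t h.1
    have h2 := h.1.ne
    have h3 := hu t
    have : t = v ∨ t = w := by tauto
    rcases this with rfl | rfl <;> tauto
  have nv2 : ∀ t, (outside G {x, y}).Adj v t →
      C₂ s(v, t) = a ∨ t = w ∧ C₂ s(v, t) = c ∨ t = u ∧ C₂ s(v, t) = d := by
    intro t h
    by_cases ht : t = u
    · subst ht; rw [Sym2.eq_swap, f2]; simp
    · rw [g2 v t hvu ht]
      have := nv t (by simp [outside_adj] at h ⊢; tauto)
      tauto
  have nw2 : ∀ t, (outside G {x, y}).Adj w t →
      C₂ s(w, t) = b ∨ t = v ∧ C₂ s(w, t) = c ∨ t = u ∧ C₂ s(w, t) = e := by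
    intro t h
    by_cases ht : t = u
    · subst ht; rw [Sym2.eq_swap, f2']; simp
    · rw [g2 w t (Ne.symm huw) ht]
      have := nw t (by simp [outside_adj] at h ⊢; tauto)
      tauto
  obtain ⟨C₃, hC₃, f3, f3', g3⟩ := hC₂.triangle (G := outside G {y}) (x := x) (u := u) (v := v)
    (α := a) (β := b) hxu (Ne.symm hvx) (Ne.symm hvu) (by simp [outside_adj])
    (by intro s t h1 h2 h; simp [outside_adj] at h ⊢; tauto)
    (by intro t h; have := hx t h.1; tauto) hab
    (by intro t h; rcases nu2 t h with ⟨_, h⟩ | ⟨_, h⟩ <;>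
        rw [h] <;> first | assumption | (apply Ne.symm; assumption))
    (by intro t h; rcases nv2 t h with h | ⟨_, h⟩ | ⟨_, h⟩ <;>
        rw [h] <;> first | assumption | (apply Ne.symm; assumption))
    (by
      intro t h1 h
      rcases nu2 t h1 with h1 | h1
      · exact absurd h1.1 h.1.ne'
      · rw [h1.1, g2 v w hvu (Ne.symm huw), f1]
        exact Ne.symm hca)
    (by intro t h _; rcases nu2 t h with ⟨_, h⟩ | ⟨_, h⟩ <;>
        rw [h] <;> first | assumption | (apply Ne.symm; assumption))
  have nu3 : ∀ t, (outside G {y}).Adj u t →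
      t = v ∧ C₃ s(u, t) = d ∨ t = w ∧ C₃ s(u, t) = e ∨ t = x ∧ C₃ s(u, t) = a := by
    intro t h
    by_cases ht : t = x
    · subst ht; rw [Sym2.eq_swap, f3]; simp
    · rw [g3 u t (Ne.symm hxu) ht]
      have := nu2 t (by simp [outside_adj] at h ⊢; tauto)
      tauto
  have nw3 : ∀ t, (outside G {y}).Adj w t →
      t ≠ x ∧ (C₃ s(w, t) = b ∨ t = v ∧ C₃ s(w, t) = c ∨ t = u ∧ C₃ s(w, t) = e) := by
    intro t h
    have ht : t ≠ x := by
      rintro rfl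
      rcases hx w h.1.symm with h | h
      · exact hvw h.symm
      · exact huw h.symm
    rw [g3 w t (Ne.symm hxw) ht]
    have := nw2 t (by simp [outside_adj] at h ⊢; tauto)
    tauto
  obtain ⟨C₄, hC₄, -⟩ := hC₃.triangle (G := G) (x := y) (u := u) (v := w)
    (α := b) (β := a) (Ne.symm huy) hyw huw (by simp [outside_adj])
    (by intro s t h1 h2 h; simp [outside_adj]; tauto)
    hy hab.symm
    (by intro t h; rcases nu3 t h with ⟨_, h⟩ | ⟨_, h⟩ | ⟨_, h⟩ <;>
        rw [h] <;> first | assumption | (apply Ne.symm; assumption))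
    (by intro t h; rcases (nw3 t h).2 with h | ⟨_, h⟩ | ⟨_, h⟩ <;>
        rw [h] <;> first | assumption | (apply Ne.symm; assumption))
    (by
      intro t h1 h
      rcases nu3 t h1 with h1 | h1 | h1
      · rw [h1.1, g3 w v (Ne.symm hxw) hvx, g2 w v (Ne.symm huw) hvu, Sym2.eq_swap, f1]
        exact Ne.symm hcb
      · exact absurd h1.1 h.1.ne'
      · exact absurd h1.1 (nw3 t h).1)
    (by
      intro t h h'
      rcases nu3 t h with h | h | h
      · rw [h.2]; first | assumption | (apply Ne.symm; assumption)
      · rw [h.2]; first | assumption | (apply Ne.symm; assumption)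
      · exact absurd h.1 (nw3 t h').1)
  exact ⟨C₄, hC₄⟩

/-- `G` lives on `{0, …, n - 1}`, contains the cycle `0, 1, …, n - 1`, and its other edges are
pairwise noncrossing chords of that cycle. -/
structure IsDissection (n : ℕ) (G : SimpleGraph ℕ) : Prop where
  three_le : 3 ≤ n
  lt : ∀ {a b}, G.Adj a b → a < n
  succ : ∀ {a}, a + 1 < n → G.Adj a (a + 1)
  ends : G.Adj 0 (n - 1)
  noncrossing : ∀ {a b c d}, a < b → b < c → c < d → G.Adj a c → G.Adj b d → False

/-- The map collapsing the interval `[i, i + m]` to `i`. -/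
def collapse (i m t : ℕ) : ℕ := if t ≤ i then t else if t ≤ i + m then i else t - m

/-- The graph obtained from `G` by contracting the interval `[i, i + m]`. -/
def contract (G : SimpleGraph ℕ) (i m : ℕ) : SimpleGraph ℕ :=
  SimpleGraph.fromRel fun a b => ∃ a' b', collapse i m a' = a ∧ collapse i m b' = b ∧ G.Adj a' b'

theorem contract_adj {G : SimpleGraph ℕ} {i m a b : ℕ} : (contract G i m).Adj a b ↔
    a ≠ b ∧ ∃ a' b', collapse i m a' = a ∧ collapse i m b' = b ∧ G.Adj a' b' := by
  simp only [contract, SimpleGraph.fromRel_adj]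
  constructor
  · rintro ⟨h, h' | ⟨a', b', h1, h2, h3⟩⟩
    · exact ⟨h, h'⟩
    · exact ⟨h, b', a', h2, h1, h3.symm⟩
  · exact fun h => ⟨h.1, .inl h.2⟩

protected theorem IsDissection.contract {n : ℕ} {G : SimpleGraph ℕ} (hG : IsDissection n G) {i m : ℕ}
    (hi : i + m < n) (hm : m + 3 ≤ n) : IsDissection (n - m) (contract G i m) where
  three_le := by omega
  lt := by
    intro a b h
    obtain ⟨-, a', b', rfl, rfl, h'⟩ := contract_adj.1 h
    have := hG.lt h'
    unfold collapse; split_ifs <;> omega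
  succ := by
    intro t ht
    rw [contract_adj]
    refine ⟨by omega, ?_⟩
    rcases lt_trichotomy t i with h | h | h
    · exact ⟨t, t + 1, by unfold collapse; split_ifs <;> omega,
        by unfold collapse; split_ifs <;> omega, hG.succ (by omega)⟩
    · exact ⟨t + m, t + m + 1, by unfold collapse; split_ifs <;> omega,
        by unfold collapse; split_ifs <;> omega, hG.succ (by omega)⟩
    · exact ⟨t + m, t + m + 1, by unfold collapse; split_ifs <;> omega,
        by unfold collapse; split_ifs <;> omega, hG.succ (by omega)⟩
  ends := by
    rw [contract_adj]
    exact ⟨by omega, 0, n - 1, by simp [collapse], by unfold collapse; split_ifs <;> omega, hG.ends⟩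
  noncrossing := by
    intro a b c d hab hbc hcd h1 h2
    obtain ⟨-, a', c', rfl, rfl, k1⟩ := contract_adj.1 h1
    obtain ⟨-, b', d', rfl, rfl, k2⟩ := contract_adj.1 h2
    have key : ∀ s t, collapse i m s < collapse i m t → s < t := by
      intro s t; unfold collapse; split_ifs <;> omega
    exact hG.noncrossing (key _ _ hab) (key _ _ hbc) (key _ _ hcd) k1 k2

theorem IsBColoring.of_contract {α : Type*} {G₀ G : SimpleGraph ℕ} {i m : ℕ} {C : Sym2 ℕ → α}
    (hC : IsBColoring (contract G i m) C) (hG : ∀ a b, G₀.Adj a b → G.Adj a b)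
    (hne : ∀ a b, G₀.Adj a b → collapse i m a ≠ collapse i m b)
    (inj : ∀ a b c, G₀.Adj a b → G₀.Adj a c → b ≠ c → collapse i m b ≠ collapse i m c) :
    IsBColoring G₀ (C ∘ Sym2.map (collapse i m)) :=
  hC.pullback _ (fun a b h => contract_adj.2 ⟨hne a b h, a, b, rfl, rfl, hG a b h⟩) inj

open Classical in
/-- The neighbours of `v` below `n`. -/
noncomputable def nbrs (n : ℕ) (G : SimpleGraph ℕ) (v : ℕ) : Finset ℕ :=
  (Finset.range n).filter (G.Adj v)

theorem IsDissection.mem_nbrs {n : ℕ} {G : SimpleGraph ℕ} (hG : IsDissection n G) {v w : ℕ} :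
    w ∈ nbrs n G v ↔ G.Adj v w := by
  simp only [nbrs, Finset.mem_filter, Finset.mem_range, and_iff_right_iff_imp]
  exact fun h => hG.lt h.symm

theorem card_nbrs_contract_le {n' : ℕ} {G : SimpleGraph ℕ} {i m c : ℕ} (T : Finset ℕ)
    (hT : ∀ a b, collapse i m a = c → G.Adj a b → collapse i m b ≠ c →
      ∃ b' ∈ T, collapse i m b' = collapse i m b) :
    (nbrs n' (contract G i m) c).card ≤ T.card := by
  refine le_trans (Finset.card_le_card (t := T.image (collapse i m)) fun d hd => ?_)
    Finset.card_image_le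
  simp only [nbrs, Finset.mem_filter, contract_adj] at hd
  obtain ⟨-, hne, a, b, rfl, rfl, h⟩ := hd
  obtain ⟨b', hb', h'⟩ := hT a b rfl h hne.symm
  exact Finset.mem_image.2 ⟨b', hb', h'⟩

theorem IsDissection.card_nbrs_contract_le_of_ne {n n' : ℕ} {G : SimpleGraph ℕ}
    (hG : IsDissection n G) {i m c Δ : ℕ} (hΔ : ∀ v, (nbrs n G v).card ≤ Δ) (hc : c ≠ i) :
    (nbrs n' (contract G i m) c).card ≤ Δ := by
  have huniq : ∃ c', ∀ a, collapse i m a = c → a = c' := by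
    refine ⟨if c < i then c else c + m, fun a ha => ?_⟩
    unfold collapse at ha
    split_ifs at ha ⊢ <;> omega
  obtain ⟨c', hc'⟩ := huniq
  refine (card_nbrs_contract_le (nbrs n G c') fun a b ha hab _ => ?_).trans (hΔ c')
  exact ⟨b, hG.mem_nbrs.2 (hc' a ha ▸ hab), rfl⟩

/-- `G` is the cycle of length four with a chord. -/
def IsBadDissection (n : ℕ) (G : SimpleGraph ℕ) : Prop := n = 4 ∧ (G.Adj 0 2 ∨ G.Adj 1 3)

theorem IsDissection.adj_iff_consecutive {n : ℕ} {G : SimpleGraph ℕ} (hG : IsDissection n G)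
    (hch : ∀ i j, i + 2 ≤ j → G.Adj i j → i = 0 ∧ j = n - 1) {a b : ℕ} (h : G.Adj a b) :
    a < n ∧ b < n ∧ (b = a + 1 ∨ a = b + 1 ∨ a = 0 ∧ b = n - 1 ∨ b = 0 ∧ a = n - 1) := by
  have h1 := hG.lt h
  have h2 := hG.lt h.symm
  have h3 := h.ne
  refine ⟨h1, h2, ?_⟩
  by_cases k1 : a + 2 ≤ b
  · have := hch a b k1 h; omega
  by_cases k2 : b + 2 ≤ a
  · have := hch b a k2 h.symm; omega
  omega

/-- The colour of the edge `ab` of a cycle of length `n`. -/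
def cycleColor (n a b : ℕ) : ℕ :=
  if a + 1 = b ∨ b + 1 = a then (if n = 4 then min a b else min a b % 2)
  else (if n = 4 then 3 else 2)

theorem cycleColor_comm (n a b : ℕ) : cycleColor n a b = cycleColor n b a := by
  unfold cycleColor; rw [min_comm]; simp only [or_comm]

theorem cycleColor_lt {n k : ℕ} (hk : 3 ≤ k) (hn : n = 4 → 4 ≤ k) {a b : ℕ} (ha : a < n)
    (hb : b < n) : cycleColor n a b < k := by
  unfold cycleColor; split_ifs <;> omega

theorem IsDissection.exists_isBColoring_cycle {n k : ℕ} {G : SimpleGraph ℕ}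
    (hG : IsDissection n G) (hk : 3 ≤ k) (hn : n = 4 → 4 ≤ k)
    (hch : ∀ i j, i + 2 ≤ j → G.Adj i j → i = 0 ∧ j = n - 1) :
    ∃ C : Sym2 ℕ → Fin k, IsBColoring G C := by
  have h3 := hG.three_le
  let f : ℕ → ℕ → Fin k := fun a b => ⟨cycleColor n a b % k, Nat.mod_lt _ (by omega)⟩
  have hf : ∀ a b, f a b = f b a := fun a b => by simp only [f, cycleColor_comm]
  have hfc : ∀ a b c d, G.Adj a b → G.Adj c d → cycleColor n a b ≠ cycleColor n c d →
      f a b ≠ f c d := by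
    intro a b c d h1 h2 h h'
    apply h
    have e1 := cycleColor_lt hk hn (hG.lt h1) (hG.lt h1.symm)
    have e2 := cycleColor_lt hk hn (hG.lt h2) (hG.lt h2.symm)
    simpa [f, Fin.ext_iff, Nat.mod_eq_of_lt e1, Nat.mod_eq_of_lt e2] using h'
  refine ⟨Sym2.lift ⟨f, hf⟩, .of_opp (fun a b c h1 h2 hbc => ?_) (fun a b c d h => ?_)⟩
  · refine hfc _ _ _ _ h1 h2 ?_
    have e1 := hG.adj_iff_consecutive hch h1
    have e2 := hG.adj_iff_consecutive hch h2
    unfold cycleColor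
    split_ifs <;> omega
  · obtain ⟨hab, hac, had, hbc, hbd, hcd, eab, ebc, ecd, eda⟩ := h
    refine hfc _ _ _ _ eab ecd ?_
    have e1 := hG.adj_iff_consecutive hch eab
    have e2 := hG.adj_iff_consecutive hch ebc
    have e3 := hG.adj_iff_consecutive hch ecd
    have e4 := hG.adj_iff_consecutive hch eda
    have hn4 : n = 4 := by omega
    subst hn4
    unfold cycleColor
    split_ifs <;> omega

/-- `ij` is a chord, and no chord lies strictly below it. -/
structure IsLeafChord (n : ℕ) (G : SimpleGraph ℕ) (i j : ℕ) : Prop where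
  add_two_le : i + 2 ≤ j
  not_root : ¬ (i = 0 ∧ j = n - 1)
  adj : G.Adj i j
  eq_of_adj : ∀ a b, i ≤ a → a < b → b ≤ j → G.Adj a b → b = a + 1 ∨ a = i ∧ b = j

/-- Every smaller dissection of maximum degree at most `Δ` is `(Δ + 1)`-colorable. -/
def SmallerColorable (n Δ : ℕ) : Prop := ∀ (n' : ℕ) (H : SimpleGraph ℕ), n' < n →
  IsDissection n' H → (∀ v, (nbrs n' H v).card ≤ Δ) → (Δ = 3 → ¬ IsBadDissection n' H) →
  ∃ C : Sym2 ℕ → Fin (Δ + 1), IsBColoring H C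

theorem IsDissection.nbr_of_inner {n : ℕ} {G : SimpleGraph ℕ} (hG : IsDissection n G) {i j x t : ℕ}
    (hl : IsLeafChord n G i j) (h1 : i < x) (h2 : x < j) (h : G.Adj x t) :
    x = t + 1 ∨ t = x + 1 := by
  by_cases k1 : t < i
  · exact (hG.noncrossing k1 h1 h2 h.symm hl.adj).elim
  by_cases k2 : j < t
  · exact (hG.noncrossing h1 h2 k2 hl.adj h).elim
  have := h.ne
  rcases lt_or_gt_of_ne this with h3 | h3
  · have := hl.eq_of_adj x t h1.le h3 (by omega) h; omega
  · have := hl.eq_of_adj t x (by omega) h3 h2.le h.symm; omega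

/-- The colors on the edges from `v` to vertices other than `x`. -/
noncomputable def colorsAt {K : Type*} [DecidableEq K] (n : ℕ) (G : SimpleGraph ℕ)
    (C : Sym2 ℕ → K) (v x : ℕ) : Finset K :=
  ((nbrs n G v).erase x).image fun t => C s(v, t)

theorem IsDissection.card_colorsAt {K : Type*} [DecidableEq K] {n : ℕ} {G : SimpleGraph ℕ}
    (hG : IsDissection n G) {C : Sym2 ℕ → K} {v x : ℕ} (h : G.Adj v x) :
    (colorsAt n G C v x).card + 1 ≤ (nbrs n G v).card := by
  have h1 : (colorsAt n G C v x).card ≤ ((nbrs n G v).erase x).card := Finset.card_image_le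
  have h2 := Finset.card_erase_add_one (hG.mem_nbrs.2 h)
  omega

theorem IsDissection.mem_colorsAt {K : Type*} [DecidableEq K] {n : ℕ} {G : SimpleGraph ℕ}
    (hG : IsDissection n G) {C : Sym2 ℕ → K} {v x t : ℕ} (h : G.Adj v t) (ht : t ≠ x) :
    C s(v, t) ∈ colorsAt n G C v x :=
  Finset.mem_image.2 ⟨t, Finset.mem_erase.2 ⟨ht, hG.mem_nbrs.2 h⟩, rfl⟩

theorem IsDissection.exists_isBColoring_of_long_leaf {n Δ : ℕ} {G : SimpleGraph ℕ}
    (hG : IsDissection n G) (h3 : 3 ≤ Δ) (hΔ : ∀ v, (nbrs n G v).card ≤ Δ)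
    (IH : SmallerColorable n Δ) {i j : ℕ} (hl : IsLeafChord n G i j) (hij : i + 4 ≤ j) :
    ∃ C : Sym2 ℕ → Fin (Δ + 1), IsBColoring G C := by
  have hn := hG.lt hl.adj.symm
  have hnr := hl.not_root
  have n1 : ∀ t, G.Adj (i + 1) t → t = i ∨ t = i + 2 := fun t h => by
    have := hG.nbr_of_inner hl (by omega) (by omega) h; omega
  have n2 : ∀ t, G.Adj (i + 2) t → t = i + 1 ∨ t = i + 3 := fun t h => by
    have := hG.nbr_of_inner hl (by omega) (by omega) h; omega
  have hd : ∀ c, (nbrs (n - 1) (contract G (i + 1) 1) c).card ≤ Δ := by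
    intro c
    by_cases hc : c = i + 1
    · refine (card_nbrs_contract_le {i, i + 3} fun a b ha hab hb => ?_).trans
        (Finset.card_le_two.trans (by omega))
      have k : a = i + 1 ∨ a = i + 2 := by
        unfold collapse at ha; split_ifs at ha <;> omega
      refine ⟨b, ?_, rfl⟩
      have : b ≠ i + 1 ∧ b ≠ i + 2 := by
        unfold collapse at hb; split_ifs at hb <;> omega
      rcases k with rfl | rfl
      · have := n1 b hab; simp; omega
      · have := n2 b hab; simp; omega
    · exact hG.card_nbrs_contract_le_of_ne hΔ hc
  obtain ⟨C, hC⟩ := IH (n - 1) (contract G (i + 1) 1) (by omega)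
    (hG.contract (by omega) (by omega)) hd (fun _ h => by have := h.1; omega)
  have hC₀ := hC.of_contract (G₀ := G.deleteEdges {s(i + 1, i + 2)})
    (fun a b h => (G.deleteEdges_adj.1 h).1)
    (fun a b h => by
      obtain ⟨h, h'⟩ := G.deleteEdges_adj.1 h
      have := h.ne
      simp only [Set.mem_singleton_iff, Sym2.eq_iff] at h'
      unfold collapse; split_ifs <;> omega)
    (fun a b c h1 h2 hbc => by
      have e1 := (G.deleteEdges_adj.1 h1).1
      have e2 := (G.deleteEdges_adj.1 h2).1
      have k1 : b = i + 1 → a = i ∨ a = i + 2 := by rintro rfl; exact n1 _ e1.symm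
      have k2 : b = i + 2 → a = i + 1 ∨ a = i + 3 := by rintro rfl; exact n2 _ e1.symm
      have k3 : c = i + 1 → a = i ∨ a = i + 2 := by rintro rfl; exact n1 _ e2.symm
      have k4 : c = i + 2 → a = i + 1 ∨ a = i + 3 := by rintro rfl; exact n2 _ e2.symm
      unfold collapse; split_ifs <;> omega)
  set C₀ := C ∘ Sym2.map (collapse (i + 1) 1) with hC₀'
  obtain ⟨γ, hγ⟩ := exists_notMem_of_card_lt
    {C₀ s(i + 1, i), C₀ s(i + 2, i + 3), C₀ s(i, i + 3)}
    (lt_of_le_of_lt Finset.card_le_three (by omega))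
  simp only [Finset.mem_insert, Finset.mem_singleton, not_or] at hγ
  obtain ⟨C', hC', -⟩ := hC₀.join (G := G) (x := i + 1) (y := i + 2) (p := i) (q := i + 3) (γ := γ)
    (fun a b h => by
      simp only [G.deleteEdges_adj, Set.mem_singleton_iff]; tauto)
    (fun t h => by
      obtain ⟨h, h'⟩ := G.deleteEdges_adj.1 h
      rcases n1 t h with rfl | rfl
      · rfl
      · simp at h')
    (fun t h => by
      obtain ⟨h, h'⟩ := G.deleteEdges_adj.1 h
      rcases n2 t h with rfl | rfl
      · simp [Sym2.eq_swap] at h'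
      · rfl)
    hγ.1 hγ.2.1 hγ.2.2 (by
      have e1 : collapse (i + 1) 1 i = i := by unfold collapse; split_ifs <;> omega
      have e2 : collapse (i + 1) 1 (i + 1) = i + 1 := by unfold collapse; split_ifs <;> omega
      have e3 : collapse (i + 1) 1 (i + 2) = i + 1 := by unfold collapse; split_ifs <;> omega
      have e4 : collapse (i + 1) 1 (i + 3) = i + 2 := by unfold collapse; split_ifs <;> omega
      simp only [hC₀', Function.comp, Sym2.map_mk, e1, e2, e3, e4]
      refine hC.1 _ _ _ ?_ ?_ (by omega)
      · exact contract_adj.2 ⟨by omega, i + 1, i, e2, e1, (hG.succ (by omega)).symm⟩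
      · exact contract_adj.2 ⟨by omega, i + 2, i + 3, e3, e4, hG.succ (by omega)⟩)
  exact ⟨C', hC'⟩

theorem IsDissection.not_isBad_of_card_le {n k : ℕ} {H : SimpleGraph ℕ} (hH : IsDissection n H)
    (h1 : (nbrs n H k).card ≤ 2) (h2 : (nbrs n H (k + 1)).card ≤ 2) (hk : k + 1 < n) :
    ¬ IsBadDissection n H := by
  rintro ⟨rfl, hb⟩
  have a01 := hH.succ (a := 0) (by omega)
  have a12 := hH.succ (a := 1) (by omega)
  have a23 := hH.succ (a := 2) (by omega)
  have a03 := hH.ends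
  have key : ∀ c p q r, H.Adj c p → H.Adj c q → H.Adj c r → p ≠ q → p ≠ r → q ≠ r →
      2 < (nbrs 4 H c).card := by
    intro c p q r hp hq hr h1 h2 h3
    rw [Finset.two_lt_card_iff]
    exact ⟨p, q, r, hH.mem_nbrs.2 hp, hH.mem_nbrs.2 hq, hH.mem_nbrs.2 hr, h1, h2, h3⟩
  rcases hb with hb | hb
  · have d0 := key 0 1 2 3 a01 hb a03 (by simp) (by simp) (by simp)
    have d2 := key 2 0 1 3 hb.symm a12.symm a23 (by simp) (by simp) (by simp)
    obtain rfl | rfl | rfl : k = 0 ∨ k = 1 ∨ k = 2 := by omega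
    all_goals simp at *; omega
  · have d1 := key 1 0 2 3 a01.symm a12 hb (by simp) (by simp) (by simp)
    have d3 := key 3 0 1 2 a03.symm hb.symm a23.symm (by simp) (by simp) (by simp)
    obtain rfl | rfl | rfl : k = 0 ∨ k = 1 ∨ k = 2 := by omega
    all_goals simp at *; omega

theorem collapse_injOn {i m a b : ℕ} (ha : a ≤ i ∨ i + m < a) (hb : b ≤ i ∨ i + m < b)
    (h : collapse i m a = collapse i m b) : a = b := by
  unfold collapse at h; split_ifs at h <;> omega

theorem IsDissection.exists_isBColoring_of_square_leaf {n Δ : ℕ} {G : SimpleGraph ℕ}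
    (hG : IsDissection n G) (h3 : 3 ≤ Δ) (hΔ : ∀ v, (nbrs n G v).card ≤ Δ)
    (IH : SmallerColorable n Δ) {i : ℕ} (hl : IsLeafChord n G i (i + 3)) :
    ∃ C : Sym2 ℕ → Fin (Δ + 1), IsBColoring G C := by
  have hn := hG.lt hl.adj.symm
  have hnr := hl.not_root
  have n1 : ∀ t, G.Adj (i + 1) t → t = i ∨ t = i + 2 := fun t h => by
    have := hG.nbr_of_inner hl (by omega) (by omega) h; omega
  have n2 : ∀ t, G.Adj (i + 2) t → t = i + 1 ∨ t = i + 3 := fun t h => by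
    have := hG.nbr_of_inner hl (by omega) (by omega) h; omega
  have a01 : G.Adj i (i + 1) := hG.succ (by omega)
  have a32 : G.Adj (i + 3) (i + 2) := (hG.succ (by omega)).symm
  have d0 : (nbrs (n - 2) (contract G i 2) i).card ≤ Δ - 1 := by
    refine (card_nbrs_contract_le ((nbrs n G i).erase (i + 1)) fun a b ha hab hb => ?_).trans ?_
    · have k : a = i ∨ a = i + 1 ∨ a = i + 2 := by
        unfold collapse at ha; split_ifs at ha <;> omega
      have k' : b ≠ i ∧ b ≠ i + 1 ∧ b ≠ i + 2 := by
        unfold collapse at hb; split_ifs at hb <;> omega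
      refine ⟨b, Finset.mem_erase.2 ⟨k'.2.1, hG.mem_nbrs.2 ?_⟩, rfl⟩
      rcases k with rfl | rfl | rfl
      · exact hab
      · have := n1 b hab; omega
      · obtain rfl : b = i + 3 := by have := n2 b hab; omega
        exact hl.adj
    · rw [Finset.card_erase_of_mem (hG.mem_nbrs.2 a01)]
      have := hΔ i; omega
  have d1 : (nbrs (n - 2) (contract G i 2) (i + 1)).card ≤ Δ - 1 := by
    refine (card_nbrs_contract_le ((nbrs n G (i + 3)).erase (i + 2))
      fun a b ha hab hb => ?_).trans ?_
    · obtain rfl : a = i + 3 := by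
        unfold collapse at ha; split_ifs at ha <;> omega
      by_cases hb2 : b = i + 2
      · refine ⟨i, Finset.mem_erase.2 ⟨by omega, hG.mem_nbrs.2 hl.adj.symm⟩, ?_⟩
        subst hb2; unfold collapse; split_ifs <;> omega
      · exact ⟨b, Finset.mem_erase.2 ⟨hb2, hG.mem_nbrs.2 hab⟩, rfl⟩
    · rw [Finset.card_erase_of_mem (hG.mem_nbrs.2 a32)]
      have := hΔ (i + 3); omega
  have hD := hG.contract (i := i) (m := 2) (by omega) (by omega)
  obtain ⟨C, hC⟩ := IH (n - 2) (contract G i 2) (by omega) hD (fun c => by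
      by_cases hc : c = i
      · subst hc; omega
      · exact hG.card_nbrs_contract_le_of_ne hΔ hc)
    (fun hd => hD.not_isBad_of_card_le (k := i) (by omega) (by omega) (by omega))
  have hS : ∀ {a b}, (outside G {i + 1, i + 2}).Adj a b ↔
      G.Adj a b ∧ (a ≠ i + 1 ∧ a ≠ i + 2) ∧ b ≠ i + 1 ∧ b ≠ i + 2 := by
    simp [outside_adj]
  have hC₀ := hC.of_contract (G₀ := outside G {i + 1, i + 2}) (fun a b h => h.1)
    (fun a b h h' => by
      have := hS.1 h
      exact h.1.ne (collapse_injOn (by omega) (by omega) h'))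
    (fun a b c h1 h2 hbc h' => by
      have := hS.1 h1
      have := hS.1 h2
      exact hbc (collapse_injOn (by omega) (by omega) h'))
  set C₀ := C ∘ Sym2.map (collapse i 2)
  have c0 := hG.card_colorsAt (C := C₀) a01
  have c3 := hG.card_colorsAt (C := C₀) a32
  have := hΔ i
  have := hΔ (i + 3)
  obtain ⟨β, hβ⟩ := exists_notMem_of_card_lt (colorsAt n G C₀ (i + 3) (i + 2)) (by omega)
  obtain ⟨α, hα⟩ := exists_notMem_of_card_lt (insert β (colorsAt n G C₀ i (i + 1)))
    (lt_of_le_of_lt (Finset.card_insert_le _ _) (by omega))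
  rw [Finset.mem_insert, not_or] at hα
  obtain ⟨C₁, hC₁, f1, g1⟩ := hC₀.pendant (G := outside G {i + 2}) (x := i + 1) (p := i)
    (fun t h => by have := hS.1 h; omega)
    (fun a b ha hb h => hS.2 (by simp [outside_adj] at h; tauto))
    (fun t h => by
      simp only [outside_adj, Set.mem_singleton_iff] at h
      have := n1 t h.1; omega) α
    (fun t h h' => hα.2 (h' ▸ hG.mem_colorsAt h.1 (hS.1 h).2.2.1))
  obtain ⟨C₂, hC₂, f2, g2⟩ := hC₁.pendant (G := G.deleteEdges {s(i + 1, i + 2)}) (x := i + 2)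
    (p := i + 3) (fun t h => by simp [outside_adj] at h)
    (fun a b ha hb h => by
      simp only [outside_adj, Set.mem_singleton_iff]
      exact ⟨(G.deleteEdges_adj.1 h).1, ha, hb⟩)
    (fun t h => by
      obtain ⟨h, h'⟩ := G.deleteEdges_adj.1 h
      rcases n2 t h with rfl | rfl
      · simp [Sym2.eq_swap] at h'
      · rfl) β
    (fun t h h' => by
      simp only [outside_adj, Set.mem_singleton_iff] at h
      have ht : t ≠ i + 1 := by rintro rfl; have := n1 _ h.1.symm; omega
      rw [g1 _ _ (by omega) ht] at h'
      exact hβ (h' ▸ hG.mem_colorsAt h.1 h.2.2))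
  have f1' : C₂ s(i + 1, i) = α := by rw [g2 _ _ (by omega) (by omega), f1]
  obtain ⟨γ, hγ⟩ := exists_notMem_of_card_lt {α, β, C₂ s(i, i + 3)}
    (lt_of_le_of_lt Finset.card_le_three (by omega))
  simp only [Finset.mem_insert, Finset.mem_singleton, not_or] at hγ
  obtain ⟨C', hC', -⟩ := hC₂.join (G := G) (x := i + 1) (y := i + 2) (p := i) (q := i + 3) (γ := γ)
    (fun a b h => by
      simp only [G.deleteEdges_adj, Set.mem_singleton_iff]; tauto)
    (fun t h => by
      obtain ⟨h, h'⟩ := G.deleteEdges_adj.1 h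
      rcases n1 t h with rfl | rfl
      · rfl
      · simp at h')
    (fun t h => by
      obtain ⟨h, h'⟩ := G.deleteEdges_adj.1 h
      rcases n2 t h with rfl | rfl
      · simp [Sym2.eq_swap] at h'
      · rfl)
    (by rw [f1']; exact hγ.1) (by rw [f2]; exact hγ.2.1) hγ.2.2 (by rw [f1', f2]; exact hα.1)
  exact ⟨C', hC'⟩

/-- The colors unavailable at `u` for the edge joining `u` to the apex `x` of a triangle on `uv`. -/
noncomputable def triangleColors {K : Type*} [DecidableEq K] (n : ℕ) (G : SimpleGraph ℕ)
    (C : Sym2 ℕ → K) (u v x : ℕ) : Finset K :=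
  colorsAt n G C u x ∪ ((nbrs n G u ∩ nbrs n G v).erase x).image fun t => C s(v, t)

theorem IsDissection.card_triangleColors {K : Type*} [DecidableEq K] {n : ℕ} {G : SimpleGraph ℕ}
    (hG : IsDissection n G) {C : Sym2 ℕ → K} {u v x : ℕ} (h : G.Adj u x) :
    (triangleColors n G C u v x).card + 1 ≤
      (nbrs n G u).card + ((nbrs n G u ∩ nbrs n G v).erase x).card := by
  have h1 := hG.card_colorsAt (C := C) h
  have h2 := Finset.card_union_le (colorsAt n G C u x)
    (((nbrs n G u ∩ nbrs n G v).erase x).image fun t => C s(v, t))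
  have h3 : (((nbrs n G u ∩ nbrs n G v).erase x).image fun t => C s(v, t)).card ≤ _ :=
    Finset.card_image_le
  unfold triangleColors
  omega

theorem IsDissection.common_nbr_unique {n : ℕ} {G : SimpleGraph ℕ} (hG : IsDissection n G)
    {k s t : ℕ} (h1 : G.Adj k s) (h2 : G.Adj (k + 2) s) (h3 : G.Adj k t) (h4 : G.Adj (k + 2) t)
    (hs : s ≠ k + 1) (ht : t ≠ k + 1) : s = t := by
  have key : ∀ s t, G.Adj k s → G.Adj (k + 2) s → G.Adj k t → G.Adj (k + 2) t → s ≠ k + 1 →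
      t ≠ k + 1 → ¬ s < t := by
    intro s t h1 h2 h3 h4 hs ht hst
    have e1 := h1.ne
    have e2 := h2.ne
    have e3 := h3.ne
    have e4 := h4.ne
    by_cases k1 : t < k
    · exact hG.noncrossing hst k1 (by omega) h1.symm h4.symm
    by_cases k2 : s < k
    · exact hG.noncrossing (b := k) (c := k + 2) k2 (by omega) (by omega) h2.symm h3
    · exact hG.noncrossing (b := k + 2) (by omega) (by omega) hst h1 h4
  by_contra hne
  rcases lt_or_gt_of_ne hne with h | h
  · exact key s t h1 h2 h3 h4 hs ht h
  · exact key t s h3 h4 h1 h2 ht hs h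

theorem exists_ne_of_card_lt {k : ℕ} {s t : Finset (Fin k)} (hs : s.card < k) (ht : t.card < k)
    (h : s.card + 1 < k ∨ t.card + 1 < k) : ∃ α β, α ≠ β ∧ α ∉ s ∧ β ∉ t := by
  rcases h with h | h
  · obtain ⟨β, hβ⟩ := exists_notMem_of_card_lt t ht
    obtain ⟨α, hα⟩ := exists_notMem_of_card_lt (insert β s)
      (lt_of_le_of_lt (Finset.card_insert_le _ _) h)
    rw [Finset.mem_insert, not_or] at hα
    exact ⟨α, β, hα.1, hα.2, hβ⟩
  · obtain ⟨α, hα⟩ := exists_notMem_of_card_lt s hs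
    obtain ⟨β, hβ⟩ := exists_notMem_of_card_lt (insert α t)
      (lt_of_le_of_lt (Finset.card_insert_le _ _) h)
    rw [Finset.mem_insert, not_or] at hβ
    exact ⟨α, β, Ne.symm hβ.1, hα, hβ.2⟩

theorem IsDissection.exists_isBColoring_of_triangle_leaf {n Δ : ℕ} {G : SimpleGraph ℕ}
    (hG : IsDissection n G) (h3 : 3 ≤ Δ) (hΔ : ∀ v, (nbrs n G v).card ≤ Δ)
    (IH : SmallerColorable n Δ) {i : ℕ} (hl : IsLeafChord n G i (i + 2))
    (hB : (nbrs n G i).card < Δ ∨ (nbrs n G (i + 2)).card < Δ ∨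
      ∀ w, G.Adj i w → G.Adj (i + 2) w → w = i + 1) :
    ∃ C : Sym2 ℕ → Fin (Δ + 1), IsBColoring G C := by
  have hn := hG.lt hl.adj.symm
  have hnr := hl.not_root
  have n1 : ∀ t, G.Adj (i + 1) t → t = i ∨ t = i + 2 := fun t h => by
    have := hG.nbr_of_inner hl (by omega) (by omega) h; omega
  have a01 : G.Adj i (i + 1) := hG.succ (by omega)
  have a21 : G.Adj (i + 2) (i + 1) := (hG.succ (by omega)).symm
  have d0 : (nbrs (n - 1) (contract G i 1) i).card ≤ Δ - 1 := by
    refine (card_nbrs_contract_le ((nbrs n G i).erase (i + 1)) fun a b ha hab hb => ?_).trans ?_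
    · have k : a = i ∨ a = i + 1 := by
        unfold collapse at ha; split_ifs at ha <;> omega
      have k' : b ≠ i ∧ b ≠ i + 1 := by
        unfold collapse at hb; split_ifs at hb <;> omega
      refine ⟨b, Finset.mem_erase.2 ⟨k'.2, hG.mem_nbrs.2 ?_⟩, rfl⟩
      rcases k with rfl | rfl
      · exact hab
      · obtain rfl : b = i + 2 := by have := n1 b hab; omega
        exact hl.adj
    · rw [Finset.card_erase_of_mem (hG.mem_nbrs.2 a01)]
      have := hΔ i; omega
  have d1 : (nbrs (n - 1) (contract G i 1) (i + 1)).card ≤ Δ - 1 := by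
    refine (card_nbrs_contract_le ((nbrs n G (i + 2)).erase (i + 1))
      fun a b ha hab hb => ?_).trans ?_
    · obtain rfl : a = i + 2 := by
        unfold collapse at ha; split_ifs at ha <;> omega
      by_cases hb2 : b = i + 1
      · refine ⟨i, Finset.mem_erase.2 ⟨by omega, hG.mem_nbrs.2 hl.adj.symm⟩, ?_⟩
        subst hb2; unfold collapse; split_ifs <;> omega
      · exact ⟨b, Finset.mem_erase.2 ⟨hb2, hG.mem_nbrs.2 hab⟩, rfl⟩
    · rw [Finset.card_erase_of_mem (hG.mem_nbrs.2 a21)]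
      have := hΔ (i + 2); omega
  have hn3 := hG.three_le
  have hD := hG.contract (i := i) (m := 1) (by omega) (by omega)
  obtain ⟨C, hC⟩ := IH (n - 1) (contract G i 1) (by omega) hD (fun c => by
      by_cases hc : c = i
      · subst hc; omega
      · exact hG.card_nbrs_contract_le_of_ne hΔ hc)
    (fun hd => hD.not_isBad_of_card_le (k := i) (by omega) (by omega) (by omega))
  have hS : ∀ {a b}, (outside G {i + 1}).Adj a b ↔ G.Adj a b ∧ a ≠ i + 1 ∧ b ≠ i + 1 := by
    simp [outside_adj]
  have hC₀ := hC.of_contract (G₀ := outside G {i + 1}) (fun a b h => h.1)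
    (fun a b h h' => by
      have := hS.1 h
      exact h.1.ne (collapse_injOn (by omega) (by omega) h'))
    (fun a b c h1 h2 hbc h' => by
      have := hS.1 h1
      have := hS.1 h2
      exact hbc (collapse_injOn (by omega) (by omega) h'))
  set C₀ := C ∘ Sym2.map (collapse i 1)
  have c0 := hG.card_triangleColors (C := C₀) (v := i + 2) a01
  have c2 := hG.card_triangleColors (C := C₀) (v := i) a21
  rw [Finset.inter_comm] at c2
  have e0 := hΔ i
  have e2 := hΔ (i + 2)
  have hc1 : ((nbrs n G i ∩ nbrs n G (i + 2)).erase (i + 1)).card ≤ 1 := by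
    rw [Finset.card_le_one]
    intro s hs t ht
    simp only [Finset.mem_erase, Finset.mem_inter, hG.mem_nbrs] at hs ht
    exact hG.common_nbr_unique hs.2.1 hs.2.2 ht.2.1 ht.2.2 hs.1 ht.1
  have hc0 : (∀ w, G.Adj i w → G.Adj (i + 2) w → w = i + 1) →
      ((nbrs n G i ∩ nbrs n G (i + 2)).erase (i + 1)).card = 0 := by
    intro h
    rw [Finset.card_eq_zero, Finset.eq_empty_iff_forall_notMem]
    intro s hs
    simp only [Finset.mem_erase, Finset.mem_inter, hG.mem_nbrs] at hs
    exact hs.1 (h s hs.2.1 hs.2.2)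
  obtain ⟨α, β, hαβ, hα, hβ⟩ := exists_ne_of_card_lt (k := Δ + 1)
    (s := triangleColors n G C₀ i (i + 2) (i + 1)) (t := triangleColors n G C₀ (i + 2) i (i + 1))
    (by omega) (by omega) (by
      rcases hB with h | h | h
      · omega
      · omega
      · have := hc0 h; omega)
  simp only [triangleColors, Finset.mem_union, not_or] at hα hβ
  have hmem : ∀ u v t, (outside G {i + 1}).Adj u t → (outside G {i + 1}).Adj v t → C₀ s(v, t) ∈
      ((nbrs n G u ∩ nbrs n G v).erase (i + 1)).image fun t => C₀ s(v, t) := fun u v t h h' =>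
    Finset.mem_image.2 ⟨t, Finset.mem_erase.2 ⟨(hS.1 h).2.2, Finset.mem_inter.2
      ⟨hG.mem_nbrs.2 h.1, hG.mem_nbrs.2 h'.1⟩⟩, rfl⟩
  obtain ⟨C', hC', -⟩ := hC₀.triangle (G := G) (x := i + 1) (u := i) (v := i + 2) (by omega)
    (by omega) (by omega) (fun t h => (hS.1 h).2.1 rfl)
    (fun a b ha hb h => hS.2 ⟨h, ha, hb⟩) n1 hαβ
    (fun t h h' => hα.1 (h' ▸ hG.mem_colorsAt h.1 (hS.1 h).2.2))
    (fun t h h' => hβ.1 (h' ▸ hG.mem_colorsAt h.1 (hS.1 h).2.2))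
    (fun t h1 h2 h' => hα.2 (h' ▸ hmem _ _ _ h1 h2))
    (fun t h1 h2 h' => hβ.2 (h' ▸ hmem _ _ _ h2 h1))
  exact ⟨C', hC'⟩

theorem card_four_of_nodup {p q r t : ℕ} (hn : [p, q, r, t].Nodup) :
    ({p, q, r, t} : Finset ℕ).card = 4 := by
  simp only [List.nodup_cons, List.mem_cons, List.not_mem_nil, or_false, not_or,
    not_false_eq_true, List.nodup_nil, and_true] at hn
  rw [Finset.card_insert_of_notMem, Finset.card_insert_of_notMem, Finset.card_insert_of_notMem,
    Finset.card_singleton] <;> simp <;> tauto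

theorem insert_four_subset {s : Finset ℕ} {p q r t : ℕ} (hp : p ∈ s) (hq : q ∈ s) (hr : r ∈ s)
    (ht : t ∈ s) : ({p, q, r, t} : Finset ℕ) ⊆ s := by
  intro y hy
  simp only [Finset.mem_insert, Finset.mem_singleton] at hy
  rcases hy with rfl | rfl | rfl | rfl <;> assumption

theorem four_le_card {s : Finset ℕ} {p q r t : ℕ} (hp : p ∈ s) (hq : q ∈ s) (hr : r ∈ s)
    (ht : t ∈ s) (hn : [p, q, r, t].Nodup) : 4 ≤ s.card :=
  (card_four_of_nodup hn).symm.le.trans (Finset.card_le_card (insert_four_subset hp hq hr ht))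

theorem eq_of_mem_of_card_le_four {s : Finset ℕ} (hs : s.card ≤ 4) {p q r t : ℕ}
    (hp : p ∈ s) (hq : q ∈ s) (hr : r ∈ s) (ht : t ∈ s) (hn : [p, q, r, t].Nodup) {x : ℕ}
    (hx : x ∈ s) : x = p ∨ x = q ∨ x = r ∨ x = t := by
  have hcard := card_four_of_nodup hn
  rw [← Finset.eq_of_subset_of_card_le (insert_four_subset hp hq hr ht) (by omega)] at hx
  simpa using hx

theorem IsDissection.exists_pred {n : ℕ} {G : SimpleGraph ℕ} (hG : IsDissection n G) {i : ℕ}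
    (hi : i < n) : ∃ z, G.Adj i z ∧ (i = 0 ∧ z = n - 1 ∨ z + 1 = i) := by
  rcases Nat.eq_zero_or_pos i with h0 | h0
  · exact ⟨n - 1, h0 ▸ hG.ends, .inl ⟨h0, rfl⟩⟩
  · refine ⟨i - 1, ?_, .inr (by omega)⟩
    have := hG.succ (a := i - 1) (by omega)
    rw [Nat.sub_add_cancel h0] at this
    exact this.symm

theorem IsDissection.exists_succ {n : ℕ} {G : SimpleGraph ℕ} (hG : IsDissection n G) {i : ℕ}
    (hi : i < n) : ∃ z, G.Adj i z ∧ (i + 1 = n ∧ z = 0 ∨ i + 1 < n ∧ z = i + 1) := by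
  rcases Nat.lt_or_ge (i + 1) n with h0 | h0
  · exact ⟨i + 1, hG.succ h0, .inr ⟨h0, rfl⟩⟩
  · refine ⟨0, ?_, .inl ⟨by omega, rfl⟩⟩
    have := hG.ends.symm
    rwa [show n - 1 = i by omega] at this

theorem IsDissection.exists_isBColoring_of_sun {n Δ : ℕ} {G : SimpleGraph ℕ}
    (hG : IsDissection n G) (h4 : Δ = 4) (hΔ : ∀ v, (nbrs n G v).card ≤ Δ)
    (IH : SmallerColorable n Δ) {i : ℕ} (hl : IsLeafChord n G i (i + 2))
    (hl' : IsLeafChord n G (i + 2) (i + 4)) (h : G.Adj i (i + 4)) (hr : ¬ (i = 0 ∧ i + 4 = n - 1)) :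
    ∃ C : Sym2 ℕ → Fin (Δ + 1), IsBColoring G C := by
  subst h4
  have hn := hG.lt h.symm
  have n1 : ∀ t, G.Adj (i + 1) t → t = i ∨ t = i + 2 := fun t h => by
    have := hG.nbr_of_inner hl (by omega) (by omega) h; omega
  have n3 : ∀ t, G.Adj (i + 3) t → t = i + 2 ∨ t = i + 4 := fun t h => by
    have := hG.nbr_of_inner hl' (by omega) (by omega) h; omega
  have n2 : ∀ t, G.Adj (i + 2) t → i ≤ t ∧ t ≤ i + 4 := fun t ht => by
    by_contra hc
    by_cases k1 : t < i
    · exact hG.noncrossing k1 (by omega) (by omega) ht.symm h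
    · exact hG.noncrossing (a := i) (b := i + 2) (by omega) (by omega) (by omega) h ht
  have a01 : G.Adj i (i + 1) := hG.succ (by omega)
  have a43 : G.Adj (i + 4) (i + 3) := (hG.succ (by omega)).symm
  obtain ⟨z₁, hz₁, hz₁'⟩ := hG.exists_pred (i := i) (by omega)
  obtain ⟨z₂, hz₂, hz₂'⟩ := hG.exists_succ hn
  have n0 : ∀ t, G.Adj i t → t = i + 1 ∨ t = i + 2 ∨ t = i + 4 ∨ t = z₁ := fun t ht =>
    eq_of_mem_of_card_le_four (hΔ i) (hG.mem_nbrs.2 a01) (hG.mem_nbrs.2 hl.adj)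
      (hG.mem_nbrs.2 h) (hG.mem_nbrs.2 hz₁) (by simp; omega) (hG.mem_nbrs.2 ht)
  have n4 : ∀ t, G.Adj (i + 4) t → t = i + 3 ∨ t = i + 2 ∨ t = i ∨ t = z₂ := fun t ht =>
    eq_of_mem_of_card_le_four (hΔ (i + 4)) (hG.mem_nbrs.2 a43) (hG.mem_nbrs.2 hl'.adj.symm)
      (hG.mem_nbrs.2 h.symm) (hG.mem_nbrs.2 hz₂) (by simp; omega) (hG.mem_nbrs.2 ht)
  let G₀ : SimpleGraph ℕ := G.deleteEdges {e | ∀ v ∈ e, i ≤ v ∧ v ≤ i + 4}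
  have hS : ∀ {a b}, G₀.Adj a b ↔
      G.Adj a b ∧ ¬ ((i ≤ a ∧ a ≤ i + 4) ∧ i ≤ b ∧ b ≤ i + 4) := by
    simp [G₀, SimpleGraph.deleteEdges_adj]
  have hout : ∀ a b, G₀.Adj a b → i ≤ a → a ≤ i + 4 → a = i ∧ b = z₁ ∨ a = i + 4 ∧ b = z₂ := by
    intro a b hab h1 h2
    obtain ⟨hg, hn⟩ := hS.1 hab
    obtain rfl | rfl | rfl | rfl | rfl :
      a = i ∨ a = i + 1 ∨ a = i + 2 ∨ a = i + 3 ∨ a = i + 4 := by omega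
    · have := n0 b hg; omega
    · have := n1 b hg; omega
    · have := n2 b hg; omega
    · have := n3 b hg; omega
    · have := n4 b hg; omega
  obtain ⟨C₀, hC₀, hne⟩ : ∃ C₀ : Sym2 ℕ → Fin 5, IsBColoring G₀ C₀ ∧
      C₀ s(i, z₁) ≠ C₀ s(i + 4, z₂) := by
    by_cases hn6 : n = 6
    · have hz : z₁ = z₂ := by omega
      have hin : ∀ a b, G₀.Adj a b → a = z₁ ∧ (b = i ∨ b = i + 4) ∨
          b = z₁ ∧ (a = i ∨ a = i + 4) := by
        intro a b hab
        have ha := hG.lt (hS.1 hab).1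
        have hb := hG.lt (hS.1 hab).1.symm
        have := hout a b hab
        have := hout b a hab.symm
        have := hab.ne
        omega
      refine ⟨fun e => if e = s(i, z₁) then 0 else 1,
        .of_opp (fun a b c h1 h2 hbc => ?_) (fun a b c d hc => ?_), ?_⟩
      · have e1 := hin a b h1
        have e2 := hin a c h2
        simp only [Sym2.eq_iff]
        have : i ≠ z₁ := hz₁.ne
        have : i + 4 ≠ z₁ := by omega
        split_ifs <;> first | (exfalso; omega) | simp
      · obtain ⟨hab, hac, had, hbc, hbd, hcd, eab, ebc, ecd, eda⟩ := hc
        have e1 := hin a b eab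
        have e2 := hin c d ecd
        omega
      · have : s(i + 4, z₂) ≠ s(i, z₁) := sym2_mk_ne (.inl (by omega)) (.inl (by omega))
        simp [this]
    · have hz : z₁ ≠ z₂ := by omega
      obtain ⟨C, hC⟩ := IH (n - 4) (contract G i 4) (by omega) (hG.contract (by omega) (by omega))
        (fun c => by
          by_cases hc : c = i
          · refine (card_nbrs_contract_le {z₁, z₂} fun a b ha hab hb => ?_).trans
              (Finset.card_le_two.trans (by omega))
            refine ⟨b, ?_, rfl⟩
            have k : i ≤ a ∧ a ≤ i + 4 := by unfold collapse at ha; split_ifs at ha <;> omega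
            have k' : ¬ (i ≤ b ∧ b ≤ i + 4) := by
              unfold collapse at hb; split_ifs at hb <;> omega
            have := hout a b (hS.2 ⟨hab, by omega⟩) k.1 k.2
            simp; omega
          · exact hG.card_nbrs_contract_le_of_ne hΔ hc)
        (by omega)
      have hcol : ∀ a b, a ≠ b → collapse i 4 a = collapse i 4 b →
          (i ≤ a ∧ a ≤ i + 4) ∧ i ≤ b ∧ b ≤ i + 4 := by
        intro a b hab h; unfold collapse at h; split_ifs at h <;> omega
      refine ⟨_, hC.of_contract (G₀ := G₀) (fun a b h => (hS.1 h).1) (fun a b h h' => ?_)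
        (fun a b c h1 h2 hbc h' => ?_), ?_⟩
      · exact (hS.1 h).2 (hcol a b h.ne h')
      · have k := hcol b c hbc h'
        have := hout b a h1.symm k.1.1 k.1.2
        have := hout c a h2.symm k.2.1 k.2.2
        omega
      · have e1 : collapse i 4 i = i := by unfold collapse; split_ifs <;> omega
        have e2 : collapse i 4 (i + 4) = i := by unfold collapse; split_ifs <;> omega
        have e3 : collapse i 4 z₁ ≠ i := by unfold collapse; split_ifs <;> omega
        have e4 : collapse i 4 z₂ ≠ i := by unfold collapse; split_ifs <;> omega
        have e5 : collapse i 4 z₁ ≠ collapse i 4 z₂ := fun h => by have := hcol _ _ hz h; omega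
        simp only [Function.comp, Sym2.map_mk, e1, e2]
        refine hC.1 _ _ _ ?_ ?_ e5
        · exact contract_adj.2 ⟨e3.symm, i, z₁, e1, rfl, hz₁⟩
        · exact contract_adj.2 ⟨e4.symm, i + 4, z₂, e2, rfl, hz₂⟩
  refine hC₀.threeTriangles (G := G) le_rfl (v := i) (x := i + 1) (u := i + 2) (y := i + 3)
    (w := i + 4) (z₁ := z₁) (z₂ := z₂) (by simp) (by simp; omega) (by simp; omega)
    (fun a b hab => ?_) (fun t ht => ?_) (fun t ht => ?_) n1 n3 (fun t ht => ?_) (fun t ht => ?_)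
    hne
  · by_cases hc : (i ≤ a ∧ a ≤ i + 4) ∧ i ≤ b ∧ b ≤ i + 4
    · right; simp only [List.mem_cons, List.not_mem_nil]; omega
    · exact .inl (hS.2 ⟨hab, hc⟩)
  · have := hout _ _ ht (by omega) (by omega); omega
  · have := hout _ _ ht (by omega) (by omega); omega
  · have := hout _ _ ht (by omega) (by omega); omega
  · have := hout _ _ ht (by omega) (by omega); omega

/-- If no leaf chord is reducible, then the graph contains three triangles around a triangle side. -/
theorem IsDissection.exists_sun {n Δ : ℕ} {G : SimpleGraph ℕ} (hG : IsDissection n G)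
    (h3 : 3 ≤ Δ) (hΔ : ∀ v, (nbrs n G v).card ≤ Δ) (hbad : Δ = 3 → ¬ IsBadDissection n G)
    (hleaf : ∀ i j, IsLeafChord n G i j → j = i + 2 ∧ (nbrs n G i).card = Δ ∧
      (nbrs n G (i + 2)).card = Δ ∧ ∃ w, G.Adj i w ∧ G.Adj (i + 2) w ∧ w ≠ i + 1)
    {a b : ℕ} (hab : a + 2 ≤ b) (hr : ¬ (a = 0 ∧ b = n - 1)) (h : G.Adj a b) :
    Δ = 4 ∧ ∃ i, IsLeafChord n G i (i + 2) ∧ IsLeafChord n G (i + 2) (i + 4) ∧ G.Adj i (i + 4) ∧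
      ¬ (i = 0 ∧ i + 4 = n - 1) := by
  classical
  let P : ℕ → Prop := fun L => ∃ i, G.Adj i (i + L) ∧ ∃ a b, i ≤ a ∧ a + 2 ≤ b ∧ b ≤ i + L ∧
    ¬ (a = i ∧ b = i + L) ∧ G.Adj a b
  have hb := hG.lt h.symm
  have hP : ∃ L, P L := ⟨n - 1, 0, by simpa using hG.ends, a, b, by omega, hab, by omega,
    by simpa using hr, h⟩
  obtain ⟨i, hij, a, b, ha, hab, hb, hne, h⟩ := Nat.find_spec hP
  have hmin : ∀ a b, i ≤ a → a + 2 ≤ b → b ≤ i + Nat.find hP →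
      ¬ (a = i ∧ b = i + Nat.find hP) → G.Adj a b → IsLeafChord n G a b := by
    intro a b ha hab hb hne h
    have hL := Nat.find_min hP (m := b - a) (by omega)
    have hj := hG.lt hij.symm
    refine ⟨hab, by omega, h, fun a' b' h1 h2 h3 h4 => ?_⟩
    by_contra hc
    exact hL ⟨a, by rwa [Nat.add_sub_cancel' (by omega)], a', b', h1, by omega, by omega, by omega,
      h4⟩
  generalize Nat.find hP = L at *
  have hj := hG.lt hij.symm
  have hl := hmin a b ha hab hb hne h
  obtain ⟨rfl, da, db, w, hw1, hw2, hw⟩ := hleaf a b hl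
  have nw1 := hw1.ne
  have nw2 := hw2.ne
  have hwi : i ≤ w := by
    by_contra hc
    by_cases hai : a = i
    · exact hG.noncrossing (b := i) (c := a + 2) (by omega) (by omega) (by omega) hw2.symm hij
    · exact hG.noncrossing (b := i) (by omega) (by omega) (by omega) hw1.symm hij
  have hwj : w ≤ i + L := by
    by_contra hc
    by_cases hai : a = i
    · exact hG.noncrossing (b := a + 2) (d := w) (by omega) (by omega) (by omega) hij hw2
    · exact hG.noncrossing (b := a) (d := w) (by omega) (by omega) (by omega) hij hw1
  have hinner : ∀ x t, i < x → x < i + L → G.Adj x t → i ≤ t ∧ t ≤ i + L := by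
    intro x t h1 h2 hxt
    by_contra hc
    by_cases k1 : t < i
    · exact hG.noncrossing k1 (by omega) (by omega) hxt.symm hij
    · exact hG.noncrossing (b := x) (d := t) (by omega) (by omega) (by omega) hij hxt
  have card3 : ∀ x p q r, (∀ t, G.Adj x t → t = p ∨ t = q ∨ t = r) → (nbrs n G x).card ≤ 3 := by
    intro x p q r hx
    refine (Finset.card_le_card (t := {p, q, r}) fun t ht => ?_).trans Finset.card_le_three
    simpa using hx t (hG.mem_nbrs.1 ht)
  have hsun : ∀ i, IsLeafChord n G i (i + 2) → IsLeafChord n G (i + 2) (i + 4) →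
      G.Adj i (i + 4) → Δ = 4 ∧ ¬ (i = 0 ∧ i + 4 = n - 1) := by
    intro i hl1 hl2 hij
    have hj := hG.lt hij.symm
    obtain ⟨-, d0, d2, -⟩ := hleaf _ _ hl1
    have h4 := four_le_card (hG.mem_nbrs.2 hl1.adj.symm) (hG.mem_nbrs.2 hl2.adj)
      (hG.mem_nbrs.2 (hG.succ (a := i + 1) (by omega)).symm)
      (hG.mem_nbrs.2 (hG.succ (a := i + 2) (by omega))) (by simp; omega)
    have h4' : (nbrs n G (i + 2)).card ≤ 4 := by
      rw [← card_four_of_nodup (p := i) (q := i + 1) (r := i + 3) (t := i + 4) (by simp)]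
      refine Finset.card_le_card fun t ht => ?_
      have ht := hG.mem_nbrs.1 ht
      have := ht.ne
      have h1 : i ≤ t := by
        by_contra hc
        exact hG.noncrossing (b := i) (by omega) (by omega) (by omega) ht.symm hij
      have h2 : t ≤ i + 4 := by
        by_contra hc
        exact hG.noncrossing (b := i + 2) (d := t) (by omega) (by omega) (by omega) hij ht
      simp; omega
    refine ⟨by omega, fun hroot => ?_⟩
    have := card3 i (i + 1) (i + 2) (i + 4) (fun t ht => by
      have := ht.ne
      have := hG.lt ht.symm
      have : t ≠ i + 3 := by
        rintro rfl
        exact hG.noncrossing (b := i + 2) (d := i + 4) (by omega) (by omega) (by omega) ht hl2.adj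
      omega)
    omega
  have hw' : w < a ∨ a + 2 < w := by omega
  rcases hw' with hw' | hw'
  · have hEq : w = i ∧ a + 2 = i + L := by
      by_contra hc
      have := (hleaf _ _ (hmin w (a + 2) hwi (by omega) hb hc hw2.symm)).1
      omega
    obtain ⟨rfl, hL⟩ := hEq
    by_cases hlen : a = w + 1
    · exfalso
      obtain rfl : L = 3 := by omega
      subst hlen
      have := card3 (w + 1) w (w + 2) (w + 3) (fun t ht => by
        have := ht.ne
        have := hinner _ _ (by omega) (by omega) ht
        omega)
      obtain rfl : Δ = 3 := by omega
      obtain ⟨z, hz, hz'⟩ := hG.exists_succ hj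
      by_cases hroot : w = 0 ∧ w + 3 = n - 1
      · obtain ⟨rfl, hn⟩ := hroot
        exact hbad rfl ⟨by omega, .inr h⟩
      · have := four_le_card (hG.mem_nbrs.2 hij.symm) (hG.mem_nbrs.2 h.symm)
          (hG.mem_nbrs.2 (hG.succ (a := w + 2) (by omega)).symm) (hG.mem_nbrs.2 hz)
          (by simp; omega)
        have := hΔ (w + 3)
        omega
    · have hl' := hmin w a le_rfl (by omega) (by omega) (by omega) hw1.symm
      obtain rfl := (hleaf _ _ hl').1
      obtain rfl : L = 4 := by omega
      obtain ⟨h4, h5⟩ := hsun w hl' hl hij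
      exact ⟨h4, w, hl', hl, hij, h5⟩
  · have hEq : a = i ∧ w = i + L := by
      by_contra hc
      have := (hleaf _ _ (hmin a w ha (by omega) hwj hc hw1)).1
      omega
    obtain ⟨rfl, rfl⟩ := hEq
    by_cases hlen : L = 3
    · exfalso
      subst hlen
      have := card3 (a + 2) a (a + 1) (a + 3) (fun t ht => by
        have := ht.ne
        have := hinner _ _ (by omega) (by omega) ht
        omega)
      obtain rfl : Δ = 3 := by omega
      obtain ⟨z, hz, hz'⟩ := hG.exists_pred (i := a) (by omega)
      by_cases hroot : a = 0 ∧ a + 3 = n - 1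
      · obtain ⟨rfl, hn⟩ := hroot
        exact hbad rfl ⟨by omega, .inl h⟩
      · have := four_le_card (hG.mem_nbrs.2 hij) (hG.mem_nbrs.2 h)
          (hG.mem_nbrs.2 (hG.succ (a := a) (by omega))) (hG.mem_nbrs.2 hz)
          (by simp; omega)
        have := hΔ a
        omega
    · have hl' := hmin (a + 2) (a + L) (by omega) (by omega) le_rfl (by omega) hw2
      obtain rfl : L = 4 := by have := (hleaf _ _ hl').1; omega
      obtain ⟨h4, h5⟩ := hsun a hl hl' hij
      exact ⟨h4, a, hl, hl', hij, h5⟩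

theorem IsDissection.exists_isBColoring {n Δ : ℕ} {G : SimpleGraph ℕ} (hG : IsDissection n G)
    (h3 : 3 ≤ Δ) (hΔ : ∀ v, (nbrs n G v).card ≤ Δ) (hbad : Δ = 3 → ¬ IsBadDissection n G) :
    ∃ C : Sym2 ℕ → Fin (Δ + 1), IsBColoring G C := by
  induction n using Nat.strong_induction_on generalizing G with
  | _ n ih =>
    have IH : SmallerColorable n Δ := fun n' H hn' hH h1 h2 => ih n' hn' hH h1 h2
    by_cases hch : ∀ i j, i + 2 ≤ j → G.Adj i j → i = 0 ∧ j = n - 1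
    · exact hG.exists_isBColoring_cycle (by omega) (by omega) hch
    push Not at hch
    obtain ⟨a, b, hab, h, hr⟩ := hch
    by_contra hC
    have hleaf : ∀ i j, IsLeafChord n G i j → j = i + 2 ∧ (nbrs n G i).card = Δ ∧
        (nbrs n G (i + 2)).card = Δ ∧ ∃ w, G.Adj i w ∧ G.Adj (i + 2) w ∧ w ≠ i + 1 := by
      intro i j hl
      have h1 : ¬ i + 4 ≤ j := fun h => hC (hG.exists_isBColoring_of_long_leaf h3 hΔ IH hl h)
      have h2 : j ≠ i + 3 := by
        rintro rfl; exact hC (hG.exists_isBColoring_of_square_leaf h3 hΔ IH hl)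
      obtain rfl : j = i + 2 := by have := hl.add_two_le; omega
      have e0 := hΔ i
      have e2 := hΔ (i + 2)
      refine ⟨rfl, ?_⟩
      by_contra hc
      refine hC (hG.exists_isBColoring_of_triangle_leaf h3 hΔ IH hl ?_)
      by_contra! hc'
      exact hc ⟨by omega, by omega, hc'.2.2⟩
    obtain ⟨h4, i, hl, hl', hi, hroot⟩ := hG.exists_sun h3 hΔ hbad hleaf hab (by tauto) h
    exact hC (hG.exists_isBColoring_of_sun h4 hΔ IH hl hl' hi hroot)

theorem induce_image_Ico_connected {V : Type*} {G : SimpleGraph V} {f : ℕ → V} {a b : ℕ}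
    (hab : a < b) (hf : ∀ t, a ≤ t → t + 1 < b → G.Adj (f t) (f (t + 1))) :
    (G.induce (f '' Set.Ico a b)).Connected := by
  induction b, hab using Nat.le_induction with
  | base =>
    have : f '' Set.Ico a a.succ = {f a} := by
      ext v
      simp only [Set.mem_image, Set.mem_Ico, Set.mem_singleton_iff]
      constructor
      · rintro ⟨t, ht, rfl⟩
        rw [show t = a by omega]
      · rintro rfl
        exact ⟨a, by omega, rfl⟩
    rw [this]
    exact ⟨.of_subsingleton⟩
  | succ b hb ih =>
    have h1 : f '' Set.Ico a (b + 1) = f '' Set.Ico a b ∪ {f (b - 1), f b} := by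
      ext v
      simp only [Set.mem_image, Set.mem_Ico, Set.mem_union, Set.mem_insert_iff,
        Set.mem_singleton_iff]
      constructor
      · rintro ⟨t, ht, rfl⟩
        by_cases h : t = b
        · subst h; simp
        · exact .inl ⟨t, by omega, rfl⟩
      · rintro (⟨t, ht, rfl⟩ | rfl | rfl)
        · exact ⟨t, by omega, rfl⟩
        · exact ⟨b - 1, by omega, rfl⟩
        · exact ⟨b, by omega, rfl⟩
    rw [h1]
    refine induce_union_connected (ih fun t h1 h2 => hf t h1 (by omega)).preconnected
      (induce_pair_connected_of_adj ?_).preconnected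
      ⟨f (b - 1), ⟨b - 1, by simp; omega, rfl⟩, by simp⟩
    have := hf (b - 1) (by omega) (by omega)
    rwa [Nat.sub_add_cancel (by omega)] at this

theorem hasMinor_completeGraph_four {V : Type*} {G : SimpleGraph V} {A B C D : Set V}
    (hA : (G.induce A).Connected) (hB : (G.induce B).Connected) (hC : (G.induce C).Connected)
    (hD : (G.induce D).Connected) (hdisj : [A, B, C, D].Pairwise Disjoint)
    (hadj : [A, B, C, D].Pairwise fun S T => ∃ s ∈ S, ∃ t ∈ T, G.Adj s t) :
    HasMinor G (completeGraph (Fin 4)) := by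
  simp only [List.pairwise_cons, List.mem_cons, List.not_mem_nil, or_false, forall_eq_or_imp,
    forall_eq, List.Pairwise.nil, and_true, IsEmpty.forall_iff, implies_true] at hdisj hadj
  obtain ⟨⟨d1, d2, d3⟩, ⟨d4, d5⟩, d6⟩ := hdisj
  obtain ⟨⟨a1, a2, a3⟩, ⟨a4, a5⟩, a6⟩ := hadj
  have sw : ∀ {S T : Set V}, (∃ s ∈ S, ∃ t ∈ T, G.Adj s t) → ∃ t ∈ T, ∃ s ∈ S, G.Adj t s :=
    fun ⟨s, hs, t, ht, h⟩ => ⟨t, ht, s, hs, h.symm⟩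
  refine ⟨![A, B, C, D], fun w => ?_, fun w₁ w₂ h => ?_, fun w₁ w₂ h => ?_⟩
  · fin_cases w <;> assumption
  · fin_cases w₁ <;> fin_cases w₂ <;>
      first | exact absurd rfl h | assumption | (apply Disjoint.symm; assumption)
  · fin_cases w₁ <;> fin_cases w₂ <;>
      first | exact absurd rfl h.ne | assumption | (apply sw; assumption)

theorem hasMinor_completeBipartiteGraph_two_three {V : Type*} {G : SimpleGraph V}
    {A B C D E : Set V} (hA : (G.induce A).Connected) (hB : (G.induce B).Connected)
    (hC : (G.induce C).Connected) (hD : (G.induce D).Connected) (hE : (G.induce E).Connected)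
    (hdisj : [A, B, C, D, E].Pairwise Disjoint)
    (hadj : ∀ S ∈ [A, B], ∀ T ∈ [C, D, E], ∃ s ∈ S, ∃ t ∈ T, G.Adj s t) :
    HasMinor G (completeBipartiteGraph (Fin 2) (Fin 3)) := by
  simp only [List.pairwise_cons, List.mem_cons, List.not_mem_nil, or_false, forall_eq_or_imp,
    forall_eq, List.Pairwise.nil, and_true, IsEmpty.forall_iff, implies_true] at hdisj hadj
  obtain ⟨⟨d1, d2, d3, d4⟩, ⟨d5, d6, d7⟩, ⟨d8, d9⟩, d10⟩ := hdisj
  obtain ⟨⟨a1, a2, a3⟩, a4, a5, a6⟩ := hadj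
  have sw : ∀ {S T : Set V}, (∃ s ∈ S, ∃ t ∈ T, G.Adj s t) → ∃ t ∈ T, ∃ s ∈ S, G.Adj t s :=
    fun ⟨s, hs, t, ht, h⟩ => ⟨t, ht, s, hs, h.symm⟩
  refine ⟨Sum.elim ![A, B] ![C, D, E], fun w => ?_, fun w₁ w₂ h => ?_, fun w₁ w₂ h => ?_⟩
  · rcases w with w | w <;> fin_cases w <;> assumption
  · rcases w₁ with w₁ | w₁ <;> rcases w₂ with w₂ | w₂ <;> fin_cases w₁ <;> fin_cases w₂ <;>
      first | exact absurd rfl h | assumption | (apply Disjoint.symm; assumption)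
  · rcases w₁ with w₁ | w₁ <;> rcases w₂ with w₂ | w₂
    · simp at h
    · fin_cases w₁ <;> fin_cases w₂ <;> assumption
    · fin_cases w₁ <;> fin_cases w₂ <;> (apply sw; assumption)
    · simp at h

/-- `f 0, …, f (m - 1)` is a cycle of `G`. -/
structure IsCycleSeq {V : Type*} (G : SimpleGraph V) (m : ℕ) (f : ℕ → V) : Prop where
  three_le : 3 ≤ m
  inj : ∀ {a b}, a < m → b < m → f a = f b → a = b
  succ : ∀ {a}, a + 1 < m → G.Adj (f a) (f (a + 1))
  ends : G.Adj (f 0) (f (m - 1))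

theorem IsCycleSeq.rotate {V : Type*} {G : SimpleGraph V} {m : ℕ} {f : ℕ → V}
    (hf : IsCycleSeq G m f) {r : ℕ} (hr : r < m) :
    IsCycleSeq G m fun t => f (if t + r < m then t + r else t + r - m) where
  three_le := hf.three_le
  inj := by
    intro a b ha hb h
    have := hf.inj (by split_ifs <;> omega) (by split_ifs <;> omega) h
    split_ifs at this <;> omega
  succ := by
    intro a ha
    by_cases h1 : a + 1 + r < m
    · have := hf.succ (a := a + r) (by omega)
      rw [if_pos (by omega), if_pos (by omega)]
      rwa [show a + 1 + r = a + r + 1 by omega]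
    · by_cases h2 : a + r < m
      · rw [if_pos h2, if_neg h1]
        have := hf.ends.symm
        rwa [show m - 1 = a + r by omega, show 0 = a + 1 + r - m by omega] at this
      · rw [if_neg h1, if_neg h2]
        have := hf.succ (a := a + r - m) (by omega)
        rwa [show a + 1 + r - m = a + r - m + 1 by omega]
  ends := by
    have h3 := hf.three_le
    rw [if_pos (by omega)]
    by_cases h : r = 0
    · subst h
      rw [if_pos (by omega)]
      exact hf.ends
    · rw [if_neg (by omega)]
      have := hf.succ (a := r - 1) (by omega)
      rw [show m - 1 + r - m = r - 1 by omega, show 0 + r = r - 1 + 1 by omega]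
      exact this.symm

theorem IsCycleSeq.disjoint_image {V : Type*} {G : SimpleGraph V} {m : ℕ} {f : ℕ → V}
    (hf : IsCycleSeq G m f) {a b c d : ℕ} (hbc : b ≤ c) (hd : d ≤ m) :
    Disjoint (f '' Set.Ico a b) (f '' Set.Ico c d) := by
  rw [Set.disjoint_left]
  rintro _ ⟨s, hs, rfl⟩ ⟨t, ht, h⟩
  simp only [Set.mem_Ico] at hs ht
  have := hf.inj (by omega) (by omega) h
  omega

theorem IsCycleSeq.induce_connected {V : Type*} {G : SimpleGraph V} {m : ℕ} {f : ℕ → V}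
    (hf : IsCycleSeq G m f) {a b : ℕ} (hab : a < b) (hb : b ≤ m) :
    (G.induce (f '' Set.Ico a b)).Connected :=
  induce_image_Ico_connected hab fun t _ h => hf.succ (by omega)

theorem IsCycleSeq.noncrossing {V : Type*} {G : SimpleGraph V} {m : ℕ} {f : ℕ → V}
    (hf : IsCycleSeq G m f) (hG : ¬ HasMinor G (completeGraph (Fin 4))) {a b c d : ℕ}
    (hab : a < b) (hbc : b < c) (hcd : c < d) (hd : d < m) (h1 : G.Adj (f a) (f c))
    (h2 : G.Adj (f b) (f d)) : False := by
  have key : ∀ {f : ℕ → V} {b c d : ℕ}, IsCycleSeq G m f → 0 < b → b < c → c < d → d < m →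
      G.Adj (f 0) (f c) → G.Adj (f b) (f d) → False := by
    intro f b c d hf hab hbc hcd hd h1 h2
    have mem : ∀ {s x y : ℕ}, x ≤ s → s < y → f s ∈ f '' Set.Ico x y :=
      fun h h' => ⟨_, ⟨h, h'⟩, rfl⟩
    have hs : ∀ t, 0 < t → t < m → G.Adj (f (t - 1)) (f t) := by
      intro t h h'
      have := hf.succ (a := t - 1) (by omega)
      rwa [Nat.sub_add_cancel h] at this
    refine hG (hasMinor_completeGraph_four (hf.induce_connected hab (by omega))
      (hf.induce_connected hbc (by omega)) (hf.induce_connected hcd (by omega))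
      (hf.induce_connected hd le_rfl) ?_ ?_)
    · simp only [List.pairwise_cons, List.mem_cons, List.not_mem_nil, or_false, forall_eq_or_imp,
        forall_eq, List.Pairwise.nil, and_true, IsEmpty.forall_iff, implies_true]
      refine ⟨⟨?_, ?_, ?_⟩, ⟨?_, ?_⟩, ?_⟩ <;> exact hf.disjoint_image (by omega) (by omega)
    · simp only [List.pairwise_cons, List.mem_cons, List.not_mem_nil, or_false, forall_eq_or_imp,
        forall_eq, List.Pairwise.nil, and_true, IsEmpty.forall_iff, implies_true]
      refine ⟨⟨?_, ?_, ?_⟩, ⟨?_, ?_⟩, ?_⟩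
      · exact ⟨_, mem (by omega) (by omega), _, mem le_rfl hbc, hs b hab (by omega)⟩
      · exact ⟨_, mem le_rfl hab, _, mem le_rfl hcd, h1⟩
      · exact ⟨_, mem le_rfl hab, _, mem (by omega) (by omega), hf.ends⟩
      · exact ⟨_, mem (by omega) (by omega), _, mem le_rfl hcd, hs c (by omega) (by omega)⟩
      · exact ⟨_, mem le_rfl hbc, _, mem le_rfl hd, h2⟩
      · exact ⟨_, mem (by omega) (by omega), _, mem le_rfl hd, hs d (by omega) (by omega)⟩
  refine key (b := b - a) (c := c - a) (d := d - a) (hf.rotate (r := a) (by omega)) (by omega)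
    (by omega) (by omega) (by omega) ?_ ?_
  · simpa [if_pos (show a < m by omega), Nat.sub_add_cancel (show a ≤ c by omega),
      if_pos (show c < m by omega)] using h1
  · simpa [Nat.sub_add_cancel (show a ≤ b by omega), Nat.sub_add_cancel (show a ≤ d by omega),
      if_pos (show b < m by omega), if_pos (show d < m by omega)] using h2

theorem exists_isCycleSeq_of_connected {V : Type*} {G : SimpleGraph V} {T : Set V} {m : ℕ}
    {f : ℕ → V} (hm : 1 ≤ m) (inj : ∀ {a b}, a < m → b < m → f a = f b → a = b)
    (succ : ∀ {a}, a + 1 < m → G.Adj (f a) (f (a + 1))) (hT : ∀ t < m, f t ∉ T)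
    (hconn : (G.induce T).Connected) {d d' : V} (hd : d ∈ T) (hd' : d' ∈ T)
    (h0 : G.Adj (f 0) d) (h1 : G.Adj (f (m - 1)) d') (hne : m = 1 → d ≠ d') :
    ∃ m' > m, ∃ g, IsCycleSeq G m' g := by
  obtain ⟨p, hp⟩ := hconn.exists_isPath ⟨d', hd'⟩ ⟨d, hd⟩
  have hl : m = 1 → 1 ≤ p.length := by
    intro h
    by_contra h'
    exact hne h (congrArg Subtype.val (Walk.eq_of_length_eq_zero (p := p) (by omega))).symm
  refine ⟨m + p.length + 1, by omega, fun t => if t < m then f t else p.getVert (t - m),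
    by omega, ?_, ?_, ?_⟩
  · intro a b ha hb h
    split_ifs at h with h1 h2 h2
    · exact inj h1 h2 h
    · exact absurd (h ▸ (p.getVert (b - m)).2) (hT a h1)
    · exact absurd (h ▸ (p.getVert (a - m)).2) (hT b h2)
    · have := hp.getVert_injOn (show a - m ∈ _ by simp; omega)
        (show b - m ∈ _ by simp; omega)
        (Subtype.ext h)
      omega
  · intro a ha
    by_cases h2 : a + 1 < m
    · rw [if_pos (by omega), if_pos h2]
      exact succ h2
    · by_cases h3 : a < m
      · rw [if_pos h3, if_neg h2, show a + 1 - m = 0 by omega, p.getVert_zero,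
          show a = m - 1 by omega]
        exact h1
      · rw [if_neg h3, if_neg h2, show a + 1 - m = a - m + 1 by omega]
        exact p.adj_getVert_succ (i := a - m) (by omega)
  · rw [if_pos (by omega), if_neg (by omega), show m + p.length + 1 - 1 - m = p.length by omega,
      p.getVert_length]
    exact h0

theorem IsTwoConnected.exists_ne {V : Type*} {G : SimpleGraph V} (hG : IsTwoConnected G)
    (a b : V) : ∃ c, c ≠ a ∧ c ≠ b := by
  classical
  have h := hG.1
  have : Finite V := Nat.finite_of_card_ne_zero (by omega)
  have := Fintype.ofFinite V
  rw [Nat.card_eq_fintype_card] at h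
  obtain ⟨c, -, hc⟩ := Finset.exists_mem_notMem_of_card_lt_card
    (s := {a, b}) (t := Finset.univ (α := V))
    (Finset.card_le_two.trans_lt (by simpa using Nat.lt_of_succ_le h))
  simp only [Finset.mem_insert, Finset.mem_singleton, not_or] at hc
  exact ⟨c, hc⟩

theorem IsTwoConnected.exists_adj_ne {V : Type*} {G : SimpleGraph V} (hG : IsTwoConnected G)
    {p a : V} (h : p ≠ a) : ∃ b, b ≠ a ∧ G.Adj p b := by
  obtain ⟨c, hc, hcp⟩ := hG.exists_ne a p
  have : Nontrivial {u | u ≠ a} :=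
    ⟨⟨⟨p, h⟩, ⟨c, hc⟩, fun h' => hcp (congrArg Subtype.val h').symm⟩⟩
  obtain ⟨b, hb⟩ := (hG.2 a).preconnected.exists_adj_of_nontrivial ⟨p, h⟩
  exact ⟨b, b.2, hb⟩

theorem IsTwoConnected.exists_isCycleSeq {V : Type*} {G : SimpleGraph V}
    (hG : IsTwoConnected G) : ∃ m f, IsCycleSeq G m f := by
  obtain ⟨q⟩ : Nonempty V := by
    have := hG.1
    by_contra h
    rw [not_nonempty_iff] at h
    simp at this
  obtain ⟨p, hpq, -⟩ := hG.exists_ne q q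
  obtain ⟨a, haq, hpa⟩ := hG.exists_adj_ne hpq
  obtain ⟨b, hba, hpb⟩ := hG.exists_adj_ne hpa.ne
  obtain ⟨m, -, g, hg⟩ := exists_isCycleSeq_of_connected (m := 1) (f := fun _ => p) le_rfl
    (by omega) (by omega) (by simp) (hG.2 p) hpa.ne' hpb.ne' hpa hpb fun _ => hba.symm
  exact ⟨m, g, hg⟩

theorem exists_connected_closed {V : Type*} (G : SimpleGraph V) {S : Set V} {x : V}
    (hx : x ∉ S) : ∃ D : Set V, x ∈ D ∧ Disjoint S D ∧ (G.induce D).Connected ∧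
      ∀ u v, u ∈ D → G.Adj u v → v ∈ S ∨ v ∈ D := by
  let c := (G.induce Sᶜ).connectedComponentMk ⟨x, hx⟩
  refine ⟨Subtype.val '' c.supp, ⟨⟨x, hx⟩, rfl, rfl⟩, ?_, ?_, ?_⟩
  · rw [Set.disjoint_right]
    rintro _ ⟨u, -, rfl⟩
    exact u.2
  · refine c.connected_toSimpleGraph.map
      (⟨fun u => ⟨u.1.1, u.1, u.2, rfl⟩, fun h => h⟩ :
        c.toSimpleGraph →g G.induce (Subtype.val '' c.supp)) ?_
    rintro ⟨_, u, hu, rfl⟩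
    exact ⟨⟨u, hu⟩, rfl⟩
  · rintro _ v ⟨u, hu, rfl⟩ huv
    by_cases hv : v ∈ S
    · exact .inl hv
    · refine .inr ⟨⟨v, hv⟩, ?_, rfl⟩
      exact (c.mem_supp_congr_adj (v := u) (w := ⟨v, hv⟩) huv).1 hu

theorem IsTwoConnected.exists_attachment {V : Type*} {G : SimpleGraph V}
    (hG : IsTwoConnected G) {S D : Set V} {x s v : V} (hx : x ∈ D) (hs : s ∈ S) (hsv : s ≠ v)
    (hv : v ∈ S) (hSD : Disjoint S D) (hD : ∀ u v, u ∈ D → G.Adj u v → v ∈ S ∨ v ∈ D) :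
    ∃ t ∈ S, t ≠ v ∧ ∃ d ∈ D, G.Adj t d := by
  have hxv : x ≠ v := fun h => Set.disjoint_left.1 hSD hv (h ▸ hx)
  obtain ⟨p⟩ := (hG.2 v).preconnected ⟨x, hxv⟩ ⟨s, hsv⟩
  obtain ⟨e, -, h1, h2⟩ := p.exists_boundary_dart {u | u.1 ∈ D} hx
    (Set.disjoint_left.1 hSD hs)
  have h3 : G.Adj e.fst.1 e.snd.1 := e.adj
  exact ⟨e.snd.1, (hD _ _ h1 h3).resolve_right h2, e.snd.2, e.fst.1, h1, h3.symm⟩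

theorem IsCycleSeq.exists_longer {V : Type*} {G : SimpleGraph V}
    (hG : ¬ HasMinor G (completeBipartiteGraph (Fin 2) (Fin 3))) {m : ℕ} {f : ℕ → V}
    (hf : IsCycleSeq G m f) {D : Set V} (hD : (G.induce D).Connected)
    (hSD : Disjoint (f '' Set.Ico 0 m) D) {j : ℕ} (hj0 : 0 < j) (hj : j < m) {d d' : V}
    (hd : d ∈ D) (hd' : d' ∈ D) (h0 : G.Adj (f 0) d) (h1 : G.Adj (f j) d') :
    ∃ m' > m, ∃ g, IsCycleSeq G m' g := by
  have h3 := hf.three_le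
  have hSD' : ∀ t < m, f t ∉ D := fun t ht => Set.disjoint_left.1 hSD ⟨t, by simpa using ht, rfl⟩
  by_cases hjm : j = m - 1
  · subst hjm
    exact exists_isCycleSeq_of_connected (by omega) hf.inj hf.succ hSD' hD hd hd' h0 h1
      (by omega)
  by_cases hj1 : j = 1
  · subst hj1
    have hr := hf.rotate (r := 1) hj
    refine exists_isCycleSeq_of_connected (by omega) hr.inj hr.succ
      (fun t ht => hSD' _ (by split_ifs <;> omega)) hD hd' hd ?_ ?_ (by omega)
    · simpa [hj] using h1
    · rw [if_neg (by omega), show m - 1 + 1 - m = 0 by omega]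
      exact h0
  refine (hG ?_).elim
  have mem : ∀ {s x y : ℕ}, x ≤ s → s < y → f s ∈ f '' Set.Ico x y :=
    fun h h' => ⟨_, ⟨h, h'⟩, rfl⟩
  have hs : ∀ t, 0 < t → t < m → G.Adj (f t) (f (t - 1)) := by
    intro t h h'
    have := hf.succ (a := t - 1) (by omega)
    rw [Nat.sub_add_cancel h] at this
    exact this.symm
  have hdis : ∀ {a b}, b ≤ m → Disjoint (f '' Set.Ico a b) D := fun h =>
    hSD.mono_left (Set.image_mono (Set.Ico_subset_Ico (Nat.zero_le _) h))
  refine hasMinor_completeBipartiteGraph_two_three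
    (hf.induce_connected (a := 0) (b := 1) (by omega) (by omega))
    (hf.induce_connected (a := j) (b := j + 1) (by omega) (by omega))
    (hf.induce_connected (a := 1) (b := j) (by omega) (by omega))
    (hf.induce_connected (a := j + 1) (b := m) (by omega) (by omega)) hD ?_ ?_
  · simp only [List.pairwise_cons, List.mem_cons, List.not_mem_nil, or_false, forall_eq_or_imp,
      forall_eq, List.Pairwise.nil, and_true, IsEmpty.forall_iff, implies_true]
    refine ⟨⟨?_, ?_, ?_, hdis (by omega)⟩, ⟨?_, ?_, hdis (by omega)⟩, ⟨?_, hdis (by omega)⟩,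
      hdis le_rfl⟩
    · exact hf.disjoint_image (by omega) (by omega)
    · exact hf.disjoint_image (by omega) (by omega)
    · exact hf.disjoint_image (by omega) (by omega)
    · exact (hf.disjoint_image (by omega) (by omega)).symm
    · exact hf.disjoint_image (by omega) (by omega)
    · exact hf.disjoint_image (by omega) (by omega)
  · simp only [List.mem_cons, List.not_mem_nil, or_false, forall_eq_or_imp, forall_eq]
    refine ⟨⟨?_, ?_, ?_⟩, ?_, ?_, ?_⟩
    · exact ⟨_, mem le_rfl (by omega), _, mem le_rfl (by omega), hf.succ (by omega)⟩
    · exact ⟨_, mem le_rfl (by omega), _, mem (s := m - 1) (by omega) (by omega), hf.ends⟩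
    · exact ⟨_, mem le_rfl (by omega), d, hd, h0⟩
    · exact ⟨_, mem le_rfl (by omega), _, mem (by omega) (by omega), hs j hj0 hj⟩
    · exact ⟨_, mem le_rfl (by omega), _, mem le_rfl (by omega), hf.succ (by omega)⟩
    · exact ⟨_, mem le_rfl (by omega), d', hd', h1⟩

theorem IsCycleSeq.le_card {V : Type*} [Fintype V] {G : SimpleGraph V} {m : ℕ} {f : ℕ → V}
    (hf : IsCycleSeq G m f) : m ≤ Fintype.card V := by
  have := Fintype.card_le_of_injective (fun i : Fin m => f i)
    fun a b h => Fin.ext (hf.inj a.2 b.2 h)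
  simpa using this

/-- A 2-connected outerplanar graph is hamiltonian. -/
theorem exists_isCycleSeq_surjective {V : Type*} [Fintype V] {G : SimpleGraph V}
    (hG : IsTwoConnected G) (hout : ¬ HasMinor G (completeBipartiteGraph (Fin 2) (Fin 3))) :
    ∃ m f, IsCycleSeq G m f ∧ ∀ v, ∃ t < m, f t = v := by
  classical
  obtain ⟨m₀, hm₀⟩ := hG.exists_isCycleSeq
  let P : ℕ → Prop := fun m => ∃ f, IsCycleSeq G m f
  have hb : ∀ m, P m → m ≤ Fintype.card V := fun m ⟨f, hf⟩ => hf.le_card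
  obtain ⟨f, hf⟩ : P (Nat.findGreatest P (Fintype.card V)) :=
    Nat.findGreatest_spec (hb _ hm₀) hm₀
  have hmax : ∀ m' > Nat.findGreatest P (Fintype.card V), ¬ P m' :=
    fun m' h h' => Nat.findGreatest_is_greatest h (hb _ h') h'
  generalize Nat.findGreatest P (Fintype.card V) = m at hf hmax
  refine ⟨m, f, hf, ?_⟩
  by_contra! ⟨x, hx⟩
  have h3 := hf.three_le
  obtain ⟨D, hxD, hSD, hDc, hD⟩ := exists_connected_closed G (S := f '' Set.Ico 0 m) (x := x) (by
    rintro ⟨t, ht, rfl⟩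
    exact hx t ht.2 rfl)
  have hmem : ∀ t < m, f t ∈ f '' Set.Ico 0 m := fun t ht => ⟨t, by simpa using ht, rfl⟩
  have h01 : f 1 ≠ f 0 := fun h => by simpa using hf.inj (by omega) (by omega) h
  obtain ⟨_, ⟨i, hi, rfl⟩, -, d, hd, hid⟩ := hG.exists_attachment hxD (hmem 1 (by omega)) h01
    (hmem 0 (by omega)) hSD hD
  have hi' : i < m := hi.2
  obtain ⟨k, hk, hki⟩ : ∃ k < m, f k ≠ f i := by
    by_cases h : i = 0
    · exact ⟨1, by omega, by rw [h]; exact h01⟩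
    · exact ⟨0, by omega, fun h' => h (hf.inj (by omega) hi' h').symm⟩
  obtain ⟨_, ⟨j, hj, rfl⟩, hji, d', hd', hjd⟩ := hG.exists_attachment hxD (hmem k hk) hki
    (hmem i hi') hSD hD
  have hj' : j < m := hj.2
  have hne : j ≠ i := fun h => hji (by rw [h])
  obtain ⟨m', hm', hP⟩ := (hf.rotate hi').exists_longer hout hDc (D := D)
    (j := if i ≤ j then j - i else j + m - i) (hSD.mono_left (by
      rintro _ ⟨t, ht, rfl⟩
      have : t < m := ht.2
      exact hmem _ (by split_ifs <;> omega))) (by split_ifs <;> omega) (by split_ifs <;> omega)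
    hd hd' (by simpa [hi'] using hid) (by
      convert hjd using 2
      split_ifs <;> omega)
  exact hmax m' hm' hP

theorem nonempty_iso_of_bijective {V W : Type*} [LinearOrder W] {G : SimpleGraph V}
    {H : SimpleGraph W} {g : W → V} (hg : g.Bijective)
    (h : ∀ a b, a < b → (G.Adj (g a) (g b) ↔ H.Adj a b)) : Nonempty (G ≃g H) := by
  refine ⟨Iso.symm ⟨Equiv.ofBijective g hg, fun {a b} => ?_⟩⟩
  simp only [Equiv.ofBijective_apply]
  rcases lt_trichotomy a b with hab | rfl | hab
  · exact h a b hab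
  · simp
  · rw [G.adj_comm, H.adj_comm]
    exact h b a hab

/-- The graph on `{0, …, n - 1}` obtained by pulling back `G` along `f`. -/
def pullbackRange {V : Type*} (G : SimpleGraph V) (n : ℕ) (f : ℕ → V) : SimpleGraph ℕ where
  Adj a b := a < n ∧ b < n ∧ G.Adj (f a) (f b)
  symm := ⟨fun _ _ h => ⟨h.2.1, h.1, h.2.2.symm⟩⟩
  loopless := ⟨fun _ h => G.loopless.irrefl _ h.2.2⟩

theorem IsCycleSeq.isDissection {V : Type*} {G : SimpleGraph V} {n : ℕ} {f : ℕ → V}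
    (hf : IsCycleSeq G n f) (hG : ¬ HasMinor G (completeGraph (Fin 4))) :
    IsDissection n (pullbackRange G n f) where
  three_le := hf.three_le
  lt h := h.1
  succ h := ⟨by omega, h, hf.succ h⟩
  ends := by
    have := hf.three_le
    exact ⟨by omega, by omega, hf.ends⟩
  noncrossing hab hbc hcd h1 h2 := hf.noncrossing hG hab hbc hcd h2.2.1 h1.2.2 h2.2.2

theorem IsCycleSeq.card_nbrs_le {V : Type*} [Fintype V] {G : SimpleGraph V}
    [DecidableRel G.Adj] {n Δ : ℕ} {f : ℕ → V} (hf : IsCycleSeq G n f)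
    (hG : IsDissection n (pullbackRange G n f)) (hΔ : ∀ v, G.degree v ≤ Δ) (v : ℕ) :
    (nbrs n (pullbackRange G n f) v).card ≤ Δ := by
  classical
  refine le_trans ?_ (hΔ (f v))
  rw [← card_neighborFinset_eq_degree]
  refine Finset.card_le_card_of_injOn f ?_ ?_
  · intro a ha
    simpa using ((hG.mem_nbrs).1 ha).2.2
  · intro a ha b hb h
    exact hf.inj ((hG.mem_nbrs).1 ha).2.1 ((hG.mem_nbrs).1 hb).2.1 h

theorem three_le_card_nbrs {n : ℕ} {G : SimpleGraph ℕ} (hG : IsDissection n G) {v a b c : ℕ}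
    (hab : a < b) (hbc : b < c) (ha : G.Adj v a) (hb : G.Adj v b) (hc : G.Adj v c) :
    3 ≤ (nbrs n G v).card := by
  have h : ({a, b, c} : Finset ℕ) ⊆ nbrs n G v := by
    intro x hx
    simp only [Finset.mem_insert, Finset.mem_singleton] at hx
    rcases hx with rfl | rfl | rfl <;> exact hG.mem_nbrs.2 ‹_›
  refine le_trans (Finset.card_eq_three.2 ⟨a, b, c, ?_, ?_, ?_, rfl⟩).ge
    (Finset.card_le_card h) <;> omega

theorem IsDissection.two_le {n Δ : ℕ} {G : SimpleGraph ℕ} (hG : IsDissection n G)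
    (hΔ : ∀ v, (nbrs n G v).card ≤ Δ) : 2 ≤ Δ := by
  have h3 := hG.three_le
  have h : ({1, n - 1} : Finset ℕ) ⊆ nbrs n G 0 := by
    intro x hx
    simp only [Finset.mem_insert, Finset.mem_singleton] at hx
    rcases hx with rfl | rfl
    · exact hG.mem_nbrs.2 (hG.succ (by omega))
    · exact hG.mem_nbrs.2 hG.ends
  have h2 := Finset.card_le_card h
  rw [Finset.card_pair (by omega)] at h2
  exact h2.trans (hΔ 0)

theorem IsDissection.eq_of_adj {n : ℕ} {G : SimpleGraph ℕ} (hG : IsDissection n G)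
    (hΔ : ∀ v, (nbrs n G v).card ≤ 2) {i j : ℕ} (hij : i + 2 ≤ j) (h : G.Adj i j) :
    i = 0 ∧ j = n - 1 := by
  have hj := hG.lt h.symm
  by_contra hne
  by_cases hi : i = 0
  · subst hi
    have := three_le_card_nbrs hG (v := 0) (a := 1) (b := j) (c := n - 1) (by omega) (by omega)
      (hG.succ (by omega)) h hG.ends
    have := hΔ 0
    omega
  · have h1 := hG.succ (a := i - 1) (by omega)
    rw [Nat.sub_add_cancel (by omega)] at h1
    have := three_le_card_nbrs hG (v := i) (a := i - 1) (b := i + 1) (c := j) (by omega)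
      (by omega) h1.symm (hG.succ (by omega)) h
    have := hΔ i
    omega

theorem IsCycleSeq.bijective {V : Type*} {G : SimpleGraph V} {n : ℕ} {f : ℕ → V}
    (hf : IsCycleSeq G n f) (hsurj : ∀ v, ∃ t < n, f t = v) {e : Fin n → Fin n}
    (he : e.Bijective) : (fun i => f (e i)).Bijective := by
  refine Function.Bijective.comp (g := fun i : Fin n => f i) ⟨fun a b h => ?_, fun v => ?_⟩ he
  · exact Fin.ext (hf.inj a.2 b.2 h)
  · obtain ⟨t, ht, rfl⟩ := hsurj v
    exact ⟨⟨t, ht⟩, rfl⟩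

theorem IsCycleSeq.nonempty_iso_cycleGraph {V : Type*} {G : SimpleGraph V} {f : ℕ → V}
    (hf : IsCycleSeq G 4 f) (hsurj : ∀ v, ∃ t < 4, f t = v) (h02 : ¬ G.Adj (f 0) (f 2))
    (h13 : ¬ G.Adj (f 1) (f 3)) : Nonempty (G ≃g cycleGraph 4) := by
  have h01 : G.Adj (f 0) (f 1) := hf.succ (by omega)
  have h12 : G.Adj (f 1) (f 2) := hf.succ (by omega)
  have h23 : G.Adj (f 2) (f 3) := hf.succ (by omega)
  have h03 : G.Adj (f 0) (f 3) := hf.ends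
  refine nonempty_iso_of_bijective (hf.bijective hsurj Function.bijective_id) fun a b hab => ?_
  fin_cases a <;> fin_cases b <;>
    first
    | exact absurd hab (by decide)
    | exact iff_of_true ‹_› (by decide)
    | exact iff_of_false ‹_› (by decide)

theorem IsCycleSeq.nonempty_iso_K4e {V : Type*} {G : SimpleGraph V} {f : ℕ → V}
    (hf : IsCycleSeq G 4 f) (hsurj : ∀ v, ∃ t < 4, f t = v)
    (hG : ¬ HasMinor G (completeGraph (Fin 4))) (h : G.Adj (f 0) (f 2) ∨ G.Adj (f 1) (f 3)) :
    Nonempty (G ≃g K4e) := by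
  have h01 : G.Adj (f 0) (f 1) := hf.succ (by omega)
  have h12 : G.Adj (f 1) (f 2) := hf.succ (by omega)
  have h23 : G.Adj (f 2) (f 3) := hf.succ (by omega)
  have h03 : G.Adj (f 0) (f 3) := hf.ends
  have h10 := h01.symm
  have h21 := h12.symm
  have h32 := h23.symm
  have h30 := h03.symm
  have hn : G.Adj (f 0) (f 2) → ¬ G.Adj (f 1) (f 3) := fun h1 h2 =>
    hf.noncrossing hG (by omega) (by omega) (by omega) (by omega) h1 h2
  rcases h with h | h
  · have h' := hn h
    refine nonempty_iso_of_bijective (hf.bijective hsurj (e := ![0, 2, 1, 3]) (by decide))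
      fun a b hab => ?_
    fin_cases a <;> fin_cases b <;>
      first
      | exact absurd hab (by decide)
      | exact iff_of_true ‹_› (by simp [K4e])
      | exact iff_of_false ‹_› (by simp [K4e])
  · have h' : ¬ G.Adj (f 0) (f 2) := fun h' => hn h' h
    refine nonempty_iso_of_bijective (hf.bijective hsurj (e := ![1, 3, 0, 2]) (by decide))
      fun a b hab => ?_
    fin_cases a <;> fin_cases b <;>
      first
      | exact absurd hab (by decide)
      | exact iff_of_true ‹_› (by simp [K4e])
      | exact iff_of_false ‹_› (by simp [K4e])

theorem qB_outerplanar_le {V : Type*} [Fintype V] [DecidableEq V] (G : SimpleGraph V)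
    [DecidableRel G.Adj] (hout : IsOuterplanar G) (h2 : IsTwoConnected G)
    (hC4 : ¬ Nonempty (G ≃g cycleGraph 4)) (hK4e : ¬ Nonempty (G ≃g K4e))
    (Δ : ℕ) (hΔ : ∀ v, G.degree v ≤ Δ) : qB G ≤ Δ + 1 := by
  obtain ⟨n, f, hf, hsurj⟩ := exists_isCycleSeq_surjective h2 hout.2
  have hH := hf.isDissection hout.1
  have hdeg := hf.card_nbrs_le hH hΔ
  have hΔ2 := hH.two_le hdeg
  obtain ⟨C, hC⟩ : ∃ C : Sym2 ℕ → Fin (Δ + 1), IsBColoring (pullbackRange G n f) C := by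
    obtain rfl | h3 := hΔ2.eq_or_lt
    · refine hH.exists_isBColoring_cycle le_rfl ?_ fun i j hij h => hH.eq_of_adj hdeg hij h
      rintro rfl
      refine (hC4 (hf.nonempty_iso_cycleGraph hsurj (fun h => ?_) fun h => ?_)).elim
      · have := hH.eq_of_adj hdeg (i := 0) (j := 2) le_rfl ⟨by omega, by omega, h⟩
        omega
      · have := hH.eq_of_adj hdeg (i := 1) (j := 3) le_rfl ⟨by omega, by omega, h⟩
        omega
    · refine hH.exists_isBColoring h3 hdeg ?_
      rintro - ⟨rfl, h⟩
      exact hK4e (hf.nonempty_iso_K4e hsurj hout.1 (h.imp (·.2.2) (·.2.2)))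
  choose g hg hfg using hsurj
  refine Nat.sInf_le ⟨_, hC.pullback g (fun a b h => ⟨hg a, hg b, ?_⟩) fun a b c _ _ hbc h => ?_⟩
  · rwa [hfg, hfg]
  · exact hbc (by rw [← hfg b, h, hfg])
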